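/- Let Z be a Borel subset of B(2) ⊂ ℝ⁴ admitting a taming function I (defined for x ∈ Z, 0 < r ≤ 256) with upper bound Λ = sup I, and set β = 1/10. Then there exist constants K₄ > 1, β̄ ∈ (0, 1/100], and δ > 0 such that for every ball B_x(r) ⊆ B(2) and every s ∈ (0,r), there exist a countable family of sets {E_i} and balls {B_{x_i}(r_i)} such that: (1) Z ∩ B_x(r) = ∪_i E_i and E_i ⊆ B_{x_i}(r_i) for each i; (2) r_i ≥ 4β̄s for every i; (3) for every i, either r_i ∈ [4β̄s, s], or B_{x_i}(r_i) ∩ D_δ(r_i) = ∅, where D_δ(t) = B(1) ∩ {z ∈ Z : I(z, βt/2) ≥ Λ − δ}; (4) Σ_i r_i² ≤ K₄ r². -/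

import Mathlib

open Metric MeasureTheory
open scoped RealInnerProductSpace

noncomputable section

abbrev E4 := EuclideanSpace ℝ (Fin 4)

/-- `D_μ²(x,r)`: the infimum over 2-dimensional affine subspaces `L ⊆ ℝ⁴` of
`r⁻⁴ ∫_{B_x(r)} dist(y,L)² dμ(y)`. -/
def Dmu2 (μ : Measure E4) (x : E4) (r : ℝ) : ℝ :=
  sInf { s : ℝ | ∃ L : AffineSubspace ℝ E4, (L : Set E4).Nonempty ∧
    Module.finrank ℝ L.direction = 2 ∧
    s = r ^ (-4 : ℤ) * ∫ y in ball x r, (Metric.infDist y (L : Set E4)) ^ 2 ∂μ }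

/-- `I` is a taming function for the Borel set `Z ⊆ B(R)`, with upper bound `Λ`,
pinching function `epsFn` and Reifenberg constant `C`. -/
def IsTamingFunctionWith (R : ℝ) (Z : Set E4) (I : E4 → ℝ → ℝ)
    (Λ : ℝ) (epsFn : ℝ → ℝ → ℝ → ℝ) (C : ℝ) : Prop :=
  -- (1) nonnegative, bounded (by Λ), continuous, nondecreasing in r
  (∀ x ∈ Z, ∀ r ∈ Set.Ioc (0:ℝ) (128 * R), 0 ≤ I x r ∧ I x r ≤ Λ) ∧
  ContinuousOn (fun p : E4 × ℝ => I p.1 p.2) (Z ×ˢ Set.Ioc (0:ℝ) (128 * R)) ∧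
  (∀ x ∈ Z, ∀ r₁ ∈ Set.Ioc (0:ℝ) (128 * R), ∀ r₂ ∈ Set.Ioc (0:ℝ) (128 * R),
    r₁ ≤ r₂ → I x r₁ ≤ I x r₂) ∧
  -- (2) the pinching property, with pinching function epsFn
  (∀ β ∈ Set.Ioo (0:ℝ) 1, ∀ β' ∈ Set.Ioo (0:ℝ) 1, ∀ τ > (0:ℝ),
    0 < epsFn β β' τ ∧
    ∀ x ∈ ball (0:E4) R, ∀ r ∈ Set.Ioc (0:ℝ) R, ∀ p : Fin 3 → E4,
      (∀ i, p i ∈ Z ∩ closedBall x r) →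
      (∀ j, β' * r ≤ Metric.infDist (p j)
        ((affineSpan ℝ (p '' ({j}ᶜ)) : AffineSubspace ℝ E4) : Set E4)) →
      (∀ i, I (p i) (2 * r) - I (p i) (β * r / 2) < epsFn β β' τ) →
      ∀ y ∈ Z ∩ closedBall x r, ∀ y' ∈ Z ∩ closedBall x r,
        |I y (β * r / 2) - I y' (β * r / 2)| < τ) ∧
  -- (3) the Reifenberg condition with constant C
  (0 < C ∧ ∀ μ : Measure E4, IsFiniteMeasure μ → μ Zᶜ = 0 →
    ∀ x ∈ closedBall (0:E4) (2 * R), ∀ r ∈ Set.Ioc (0:ℝ) (2 * R),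
      Dmu2 μ x r ≤ C / r ^ 2 * ∫ z in ball x r, (I z (32 * r) - I z (2 * r)) ∂μ)

abbrev E5 := EuclideanSpace ℝ (Fin 5)

def kerJ (r : ℝ) : ℝ :=
  (max (2 - r) 0) ^ 5 * (2048 + 2600*r + 1380*r^2 + 350*r^3 + 35*r^4) / 161280
def kerK (r : ℝ) : ℝ :=
  (max (2 - r) 0) ^ 6 * (2048 + 6144*r + 5120*r^2 + 2060*r^3 + 420*r^4 + 35*r^5) / 1774080
def kerP (r : ℝ) : ℝ :=
  (max (2 - r) 0) ^ 7 *
    (3072 + 10752*r + 14848*r^2 + 8960*r^3 + 2880*r^4 + 490*r^5 + 35*r^6) / 23063040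

lemma inner_int (b q : ℝ) (hq : 0 ≤ q) :
    ∫ y in Set.Ioi (0:ℝ), y ^ 3 * ((max 0 (b - y^2))^2 * (max 0 (b + q - y^2))^2)
      = (max 0 b)^4 * (b^2/30 + q*b/10 + q^2/12) / 2 := by
  rcases le_or_gt b 0 with hb | hb
  · rw [max_eq_left hb]
    have : ∀ y : ℝ, max 0 (b - y^2) = 0 := fun y => max_eq_left (by nlinarith [sq_nonneg y])
    simp [this]
  · have hs : 0 < Real.sqrt b := Real.sqrt_pos.2 hb
    have hsq : Real.sqrt b ^ 2 = b := Real.sq_sqrt hb.le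
    set s := Real.sqrt b with hsdef
    rw [max_eq_right hb.le]
    have e1 : ∫ y in Set.Ioi (0:ℝ), y ^ 3 * ((max 0 (b - y^2))^2 * (max 0 (b + q - y^2))^2)
        = ∫ y in Set.Ioc (0:ℝ) s, y ^ 3 * ((b - y^2)^2 * (b + q - y^2)^2) := by
      have h1 : ∫ y in Set.Ioi (0:ℝ), y ^ 3 * ((max 0 (b - y^2))^2 * (max 0 (b + q - y^2))^2)
        = ∫ y in Set.Ioc (0:ℝ) s, y ^ 3 * ((max 0 (b - y^2))^2 * (max 0 (b + q - y^2))^2) := by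
        apply setIntegral_eq_of_subset_of_forall_sdiff_eq_zero measurableSet_Ioi
          Set.Ioc_subset_Ioi_self
        intro x hx
        have hx1 : 0 < x := hx.1
        have hx2 : s < x := by
          by_contra hh
          exact hx.2 ⟨hx1, not_lt.1 hh⟩
        have : max 0 (b - x^2) = 0 := max_eq_left (by nlinarith)
        simp [this]
      rw [h1]
      apply setIntegral_congr_fun measurableSet_Ioc
      intro x hx
      have h2 : 0 ≤ b - x^2 := by nlinarith [hx.1, hx.2]
      simp only
      rw [max_eq_right h2, max_eq_right (by linarith)]
    rw [e1, ← intervalIntegral.integral_of_le hs.le]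
    rw [intervalIntegral.integral_eq_sub_of_hasDerivAt
      (f := fun y => b^2*(b+q)^2*y^4/4 + (-2*b*(b+q)^2 - 2*b^2*(b+q))*y^6/6
        + ((b+q)^2 + b^2 + 4*b*(b+q))*y^8/8 + (-2*b-2*(b+q))*y^10/10 + y^12/12)]
    · have : ∀ k, s^(2*k) = b^k := fun k => by rw [pow_mul, hsq]
      have h4 := this 2
      have h6 := this 3
      have h8 := this 4
      have h10 := this 5
      have h12 := this 6
      norm_num at h4 h6 h8 h10 h12
      simp only [h4, h6, h8, h10, h12]
      ring
    · intro x _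
      have := (((((hasDerivAt_pow 4 x).const_mul (b^2*(b+q)^2)).div_const 4).add
        (((hasDerivAt_pow 6 x).const_mul (-2*b*(b+q)^2 - 2*b^2*(b+q))).div_const 6)).add
        (((hasDerivAt_pow 8 x).const_mul ((b+q)^2 + b^2 + 4*b*(b+q))).div_const 8)).add
        (((hasDerivAt_pow 10 x).const_mul (-2*b-2*(b+q))).div_const 10) |>.add
        ((hasDerivAt_pow 12 x).div_const 12)
      refine this.congr_deriv ?_
      push_cast
      ring
    · apply Continuous.intervalIntegrable
      fun_prop

lemma outer_int (a : ℝ) (ha : 0 ≤ a) :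
    ∫ y in Set.Ioi (0:ℝ), (max 0 (1 - (y+a)^2))^4 *
      ((1 - (y+a)^2)^2/30 + (4*a*y)*(1 - (y+a)^2)/10 + (4*a*y)^2/12) / 2
      = kerP (2*a) / 3 := by
  rcases le_or_gt 1 a with h1 | h1
  · have : ∀ y ∈ Set.Ioi (0:ℝ), (max 0 (1 - (y+a)^2))^4 *
      ((1 - (y+a)^2)^2/30 + (4*a*y)*(1 - (y+a)^2)/10 + (4*a*y)^2/12) / 2 = 0 := by
      intro y hy
      have hy : 0 < y := hy
      have : max 0 (1 - (y+a)^2) = 0 := max_eq_left (by nlinarith)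
      simp [this]
    rw [setIntegral_congr_fun measurableSet_Ioi this]
    have : max (2 - 2*a) 0 = 0 := max_eq_right (by linarith)
    simp [kerP, this]
  · have hm : max (2 - 2*a) 0 = 2 - 2*a := max_eq_left (by linarith)
    have e1 : ∫ y in Set.Ioi (0:ℝ), (max 0 (1 - (y+a)^2))^4 *
      ((1 - (y+a)^2)^2/30 + (4*a*y)*(1 - (y+a)^2)/10 + (4*a*y)^2/12) / 2
       = ∫ y in Set.Ioc (0:ℝ) (1-a), ((1 - (y+a)^2))^4 *
      ((1 - (y+a)^2)^2/30 + (4*a*y)*(1 - (y+a)^2)/10 + (4*a*y)^2/12) / 2 := by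
      have h1 : ∫ y in Set.Ioi (0:ℝ), (max 0 (1 - (y+a)^2))^4 *
      ((1 - (y+a)^2)^2/30 + (4*a*y)*(1 - (y+a)^2)/10 + (4*a*y)^2/12) / 2
        = ∫ y in Set.Ioc (0:ℝ) (1-a), (max 0 (1 - (y+a)^2))^4 *
      ((1 - (y+a)^2)^2/30 + (4*a*y)*(1 - (y+a)^2)/10 + (4*a*y)^2/12) / 2 := by
        apply setIntegral_eq_of_subset_of_forall_sdiff_eq_zero measurableSet_Ioi
          Set.Ioc_subset_Ioi_self
        intro x hx
        have hx1 : 0 < x := hx.1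
        have hx2 : 1 - a < x := by
          by_contra hh
          exact hx.2 ⟨hx1, not_lt.1 hh⟩
        have : max 0 (1 - (x+a)^2) = 0 := max_eq_left (by nlinarith)
        simp [this]
      rw [h1]
      apply setIntegral_congr_fun measurableSet_Ioc
      intro x hx
      have h2 : 0 ≤ 1 - (x+a)^2 := by nlinarith [hx.1, hx.2]
      simp only
      rw [max_eq_right h2]
    rw [e1, ← intervalIntegral.integral_of_le (by linarith)]
    let B4 : ℝ → ℝ := fun u => u - 4*u^3/3 + 6*u^5/5 - 4*u^7/7 + u^9/9
    let U4 : ℝ → ℝ := fun u => u^3/3 - 4*u^5/5 + 6*u^7/7 - 4*u^9/9 + u^11/11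
    have hB4 : ∀ u, HasDerivAt B4 ((1-u^2)^4) u := by
      intro u
      have := (((((hasDerivAt_id' u).sub (((hasDerivAt_pow 3 u).const_mul 4).div_const 3)).add
        (((hasDerivAt_pow 5 u).const_mul 6).div_const 5)).sub
        (((hasDerivAt_pow 7 u).const_mul 4).div_const 7))).add
        ((hasDerivAt_pow 9 u).div_const 9)
      refine this.congr_deriv ?_
      push_cast; ring
    have hU4 : ∀ u, HasDerivAt U4 (u^2*(1-u^2)^4) u := by
      intro u
      have := ((((((hasDerivAt_pow 3 u)).div_const 3).sub
        (((hasDerivAt_pow 5 u).const_mul 4).div_const 5)).add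
        (((hasDerivAt_pow 7 u).const_mul 6).div_const 7))).sub
        (((hasDerivAt_pow 9 u).const_mul 4).div_const 9) |>.add
        ((hasDerivAt_pow 11 u).div_const 11)
      refine this.congr_deriv ?_
      push_cast; ring
    let B5 : ℝ → ℝ := fun u => B4 u - U4 u
    have hB5 : ∀ u, HasDerivAt B5 ((1-u^2)^5) u := by
      intro u
      refine ((hB4 u).sub (hU4 u)).congr_deriv ?_
      ring
    let B6 : ℝ → ℝ := fun u => u - 6*u^3/3 + 15*u^5/5 - 20*u^7/7 + 15*u^9/9 - 6*u^11/11 + u^13/13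
    have hB6 : ∀ u, HasDerivAt B6 ((1-u^2)^6) u := by
      intro u
      have := (((((hasDerivAt_id' u).sub (((hasDerivAt_pow 3 u).const_mul 6).div_const 3)).add
        (((hasDerivAt_pow 5 u).const_mul 15).div_const 5)).sub
        (((hasDerivAt_pow 7 u).const_mul 20).div_const 7))).add
        (((hasDerivAt_pow 9 u).const_mul 15).div_const 9) |>.sub
        (((hasDerivAt_pow 11 u).const_mul 6).div_const 11) |>.add
        ((hasDerivAt_pow 13 u).div_const 13)
      refine this.congr_deriv ?_
      push_cast; ring
    have hS : ∀ (k : ℕ) (u : ℝ), HasDerivAt (fun u : ℝ => -(1-u^2)^(k+1)/(2*(k+1))) (u*(1-u^2)^k) u := by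
      intro k u
      have := ((((hasDerivAt_pow 2 u).const_sub 1).pow (k+1)).neg).div_const (2*((k:ℝ)+1))
      refine this.congr_deriv ?_
      have : (k:ℝ)+1 ≠ 0 := by positivity
      field_simp
      push_cast
      ring
    let A : ℝ → ℝ := fun u => (B6 u /30 + (4*a*(-(1-u^2)^(5+1)/(2*((5:ℕ)+1))) - 4*a^2*B5 u)/10
       + 16*a^2*(U4 u - 2*a*(-(1-u^2)^(4+1)/(2*((4:ℕ)+1))) + a^2*B4 u)/12)/2
    have hA : ∀ u, HasDerivAt A (((1 - u^2))^4 *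
      ((1 - u^2)^2/30 + (4*a*(u-a))*(1 - u^2)/10 + (4*a*(u-a))^2/12) / 2) u := by
      intro u
      have := ((((hB6 u).div_const 30).add ((((hS 5 u).const_mul (4*a)).sub
        ((hB5 u).const_mul (4*a^2))).div_const 10)).add
        (((((hU4 u).sub ((hS 4 u).const_mul (2*a))).add ((hB4 u).const_mul (a^2))).const_mul
          (16*a^2)).div_const 12)).div_const 2
      refine this.congr_deriv ?_
      ring
    rw [intervalIntegral.integral_eq_sub_of_hasDerivAt (f := fun y => A (y + a))]
    · simp only [A, B6, B5, B4, U4, kerP, hm]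
      push_cast
      ring
    · intro y _
      have := (hA (y+a)).comp_add_const y a
      refine this.congr_deriv ?_
      ring
    · apply Continuous.intervalIntegrable
      fun_prop

def bump5 (p : E5) : ℝ := (max 0 (1 - ‖p‖^2))^2

lemma bump5_cont : Continuous bump5 := by
  unfold bump5; fun_prop

lemma bump5_supp (p : E5) (h : 1 ≤ ‖p‖) : bump5 p = 0 := by
  have : max 0 (1 - ‖p‖^2) = 0 := max_eq_left (by nlinarith)
  simp [bump5, this]

lemma bump5_cs : HasCompactSupport bump5 := by
  apply HasCompactSupport.of_support_subset_isCompact (isCompact_closedBall (0:E5) 1)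
  intro p hp
  rw [mem_closedBall_zero_iff]
  by_contra h
  exact hp (bump5_supp p (not_le.1 h).le)

lemma bump5_prod_int (X Y : E5) : Integrable (fun p => bump5 (p - X) * bump5 (p - Y)) := by
  apply Continuous.integrable_of_hasCompactSupport
  · have := bump5_cont
    fun_prop
  · apply HasCompactSupport.mul_right
    have := bump5_cs.comp_homeomorph (Homeomorph.subRight X)
    exact this

lemma norm5 (p : E5) (a : ℝ) : ‖p - EuclideanSpace.single 0 a‖^2
    = (p 0 - a)^2 + ‖(WithLp.toLp 2 (fun i : Fin 4 => p i.succ) : E4)‖^2 := by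
  rw [EuclideanSpace.norm_sq_eq, EuclideanSpace.norm_sq_eq, Fin.sum_univ_succ]
  simp [Fin.succ_ne_zero]

def sliceEquiv : E5 ≃ᵐ ℝ × E4 :=
  ((MeasurableEquiv.toLp 2 (Fin 5 → ℝ)).symm.trans
    (MeasurableEquiv.piFinSuccAbove (fun _ : Fin 5 => ℝ) 0)).trans
    ((MeasurableEquiv.refl ℝ).prodCongr (MeasurableEquiv.toLp 2 (Fin 4 → ℝ)))

lemma sliceEquiv_mp : MeasurePreserving sliceEquiv (volume : Measure E5) (volume.prod volume) := by
  have h1 := EuclideanSpace.volume_preserving_symm_measurableEquiv_toLp (Fin 5)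
  have h2 := volume_preserving_piFinSuccAbove (fun _ : Fin 5 => ℝ) 0
  have h3 : MeasurePreserving ((MeasurableEquiv.refl ℝ).prodCongr (MeasurableEquiv.toLp 2 (Fin 4 → ℝ)))
    (volume.prod volume) (volume.prod volume) :=
    (MeasurePreserving.id volume).prod
    (EuclideanSpace.volume_preserving_symm_measurableEquiv_toLp (Fin 4)).symm
  exact h3.comp (h2.comp h1)

lemma sliceEquiv_apply (p : E5) : sliceEquiv p =
   (p 0, (WithLp.toLp 2 (fun i : Fin 4 => p i.succ) : E4)) := rfl

def cB : ℝ := (volume : Measure E4).real (ball 0 1)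
lemma cB_pos : 0 < cB := by
  unfold cB
  exact ENNReal.toReal_pos (measure_ball_pos _ _ one_pos).ne' measure_ball_lt_top.ne

lemma inner4 (y a : ℝ) (ha : 0 ≤ a) :
   ∫ q : E4, (max 0 (1 - ((y - a)^2 + ‖q‖^2)))^2 * (max 0 (1 - ((y + a)^2 + ‖q‖^2)))^2
    = 4 * cB * ((max 0 (1 - (|y|+a)^2))^4 *
      ((1 - (|y|+a)^2)^2/30 + (4*a*|y|)*(1 - (|y|+a)^2)/10 + (4*a*|y|)^2/12) / 2) := by
  have h := integral_fun_norm_addHaar (volume : Measure E4)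
    (fun t : ℝ => (max 0 ((1 - (|y|+a)^2) - t^2))^2 * (max 0 ((1 - (|y|+a)^2) + 4*a*|y| - t^2))^2)
  have e : ∀ q : E4, (max 0 (1 - ((y - a)^2 + ‖q‖^2)))^2 * (max 0 (1 - ((y + a)^2 + ‖q‖^2)))^2
     = (max 0 ((1 - (|y|+a)^2) - ‖q‖^2))^2 * (max 0 ((1 - (|y|+a)^2) + 4*a*|y| - ‖q‖^2))^2 := by
    intro q
    rcases abs_cases y with ⟨h1, -⟩ | ⟨h1, -⟩
    · rw [h1, mul_comm]; congr 3 <;> ring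
    · rw [h1]; congr 3 <;> ring
  simp_rw [e]
  rw [h]
  simp only [finrank_euclideanSpace, Fintype.card_fin, smul_eq_mul, nsmul_eq_mul, Nat.cast_ofNat]
  have := inner_int (1 - (|y|+a)^2) (4*a*|y|) (by positivity)
  norm_num at this ⊢
  rw [this]
  unfold cB
  ring

lemma conv_axis (a : ℝ) (ha : 0 ≤ a) :
    ∫ p : E5, bump5 (p - EuclideanSpace.single 0 a) * bump5 (p - EuclideanSpace.single 0 (-a))
      = 8 / 3 * cB * kerP (2*a) := by
  let F : ℝ × E4 → ℝ := fun w =>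
    (max 0 (1 - ((w.1 - a)^2 + ‖w.2‖^2)))^2 * (max 0 (1 - ((w.1 + a)^2 + ‖w.2‖^2)))^2
  have e : ∀ p : E5, bump5 (p - EuclideanSpace.single 0 a) * bump5 (p - EuclideanSpace.single 0 (-a))
      = F (sliceEquiv p) := by
    intro p
    simp only [bump5, F, norm5, sliceEquiv_apply, sub_neg_eq_add]
  have hFint : Integrable F (volume.prod volume) := by
    rw [← sliceEquiv_mp.integrable_comp_emb sliceEquiv.measurableEmbedding]
    have := bump5_prod_int (EuclideanSpace.single 0 a) (EuclideanSpace.single 0 (-a))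
    refine this.congr (Filter.Eventually.of_forall e)
  simp_rw [e]
  rw [sliceEquiv_mp.integral_comp' F, integral_prod F hFint]
  simp only [F]
  simp_rw [inner4 _ a ha]
  rw [integral_comp_abs (f := fun y => 4 * cB * ((max 0 (1 - (y+a)^2))^4 *
      ((1 - (y+a)^2)^2/30 + (4*a*y)*(1 - (y+a)^2)/10 + (4*a*y)^2/12) / 2)),
    integral_const_mul, outer_int a ha]
  ring

lemma conv_eq (X Y : E5) :
    ∫ p : E5, bump5 (p - X) * bump5 (p - Y) = 8 / 3 * cB * kerP ‖X - Y‖ := by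
  set h : E5 := (1/2 : ℝ) • (X - Y) with hh
  set a : ℝ := ‖h‖ with ha
  have hn : ‖X - Y‖ = 2 * a := by
    rw [ha, hh, norm_smul]; norm_num; ring
  rw [hn, ← conv_axis a (norm_nonneg _)]
  have h1 := integral_add_right_eq_self (μ := (volume : Measure E5))
    (fun p => bump5 (p - X) * bump5 (p - Y)) ((1/2 : ℝ) • (X + Y))
  rw [← h1]
  set w : E5 := EuclideanSpace.single 0 a with hw
  have hnw : ‖h‖ = ‖w‖ := by simp [hw, ha]
  let A := (ℝ ∙ (h - w))ᗮ.reflection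
  have hA : A h = w := Submodule.reflection_sub hnw
  have h2 := A.measurePreserving.integral_comp' (f := A.toHomeomorph.toMeasurableEquiv)
    (fun p => bump5 (p - EuclideanSpace.single 0 a) * bump5 (p - EuclideanSpace.single 0 (-a)))
  rw [← h2]
  congr 1
  ext p
  have hneg : (EuclideanSpace.single 0 (-a) : E5) = - A h := by
    rw [hA, hw]; ext i; simp
    split_ifs <;> simp
  have e1 : p + (1/2 : ℝ) • (X + Y) - X = p - h := by rw [hh]; module
  have e2 : p + (1/2 : ℝ) • (X + Y) - Y = p + h := by rw [hh]; module
  have hbA : ∀ v, bump5 (A v) = bump5 v := by intro v; simp [bump5]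
  rw [e1, e2, hneg, ← hw, ← hA]
  change _ = bump5 (A p - A h) * bump5 (A p - - A h)
  rw [sub_neg_eq_add, ← map_sub, ← map_add, hbA, hbA]

/-- `kerP` is positive definite on `E4`. -/
lemma kerP_pd {ι : Type*} (s : Finset ι) (c : ι → ℝ) (x : ι → E4) :
    0 ≤ ∑ i ∈ s, ∑ j ∈ s, c i * c j * kerP ‖x i - x j‖ := by
  let emb : E4 → E5 := fun v => WithLp.toLp 2 (Fin.cons 0 (fun i => v i))
  have hemb : ∀ v w, ‖emb v - emb w‖ = ‖v - w‖ := by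
    intro v w
    rw [EuclideanSpace.norm_eq, EuclideanSpace.norm_eq, Fin.sum_univ_succ]
    simp [emb]
  have h1 : 0 ≤ ∫ p : E5, (∑ i ∈ s, c i * bump5 (p - emb (x i)))^2 :=
    integral_nonneg (fun p => sq_nonneg _)
  have h2 : ∫ p : E5, (∑ i ∈ s, c i * bump5 (p - emb (x i)))^2
      = ∑ i ∈ s, ∑ j ∈ s, c i * c j * (8 / 3 * cB * kerP ‖x i - x j‖) := by
    have : ∀ p : E5, (∑ i ∈ s, c i * bump5 (p - emb (x i)))^2 =
      ∑ i ∈ s, ∑ j ∈ s, c i * c j * (bump5 (p - emb (x i)) * bump5 (p - emb (x j))) := by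
      intro p
      rw [sq, Finset.sum_mul_sum]
      refine Finset.sum_congr rfl fun i _ => Finset.sum_congr rfl fun j _ => by ring
    simp_rw [this]
    rw [integral_finsetSum _ (fun i _ => integrable_finsetSum _ (fun j _ =>
      (bump5_prod_int _ _).const_mul _))]
    refine Finset.sum_congr rfl fun i _ => ?_
    rw [integral_finsetSum _ (fun j _ => (bump5_prod_int _ _).const_mul _)]
    refine Finset.sum_congr rfl fun j _ => ?_
    rw [integral_const_mul, conv_eq, hemb]
  rw [h2] at h1
  have h3 : ∑ i ∈ s, ∑ j ∈ s, c i * c j * (8 / 3 * cB * kerP ‖x i - x j‖)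
     = (8/3*cB) * ∑ i ∈ s, ∑ j ∈ s, c i * c j * kerP ‖x i - x j‖ := by
    simp_rw [Finset.mul_sum]
    refine Finset.sum_congr rfl fun i _ => Finset.sum_congr rfl fun j _ => by ring
  rw [h3] at h1
  have := cB_pos
  exact nonneg_of_mul_nonneg_right h1 (by positivity)

lemma hasDerivAt_maxpow (k : ℕ) (r : ℝ) :
    HasDerivAt (fun r : ℝ => (max (2 - r) 0)^(k+2)) (-((k+2 : ℕ):ℝ) * (max (2 - r) 0)^(k+1)) r := by
  rcases lt_trichotomy r 2 with h | h | h
  · have h1 : HasDerivAt (fun r : ℝ => (2 - r)^(k+2)) (((k+2:ℕ):ℝ) * (2-r)^(k+1) * (-1)) r := by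
      exact ((hasDerivAt_id' r).const_sub 2).pow (k+2)
    rw [max_eq_left (by linarith)]
    refine (h1.congr_of_eventuallyEq ?_).congr_deriv (by ring)
    filter_upwards [Iio_mem_nhds h] with x hx
    rw [max_eq_left (by linarith [Set.mem_Iio.1 hx])]
  · subst h
    have : max (2 - 2 : ℝ) 0 = 0 := by simp
    rw [this, zero_pow (by omega), mul_zero]
    rw [hasDerivAt_iff_isLittleO]
    have h1 : (fun x : ℝ => (x - 2)^2) =o[nhds 2] (fun x => x - 2) := by
      have := (Asymptotics.isLittleO_pow_sub_sub (2:ℝ) (m := 2) (by norm_num))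
      simpa using this
    refine Asymptotics.IsBigO.trans_isLittleO (g := fun x : ℝ => (x-2)^2) ?_ h1
    refine Asymptotics.IsBigO.of_bound 1 ?_
    filter_upwards [Icc_mem_nhds (show (1:ℝ) < 2 by norm_num) (show (2:ℝ) < 3 by norm_num)] with x hx
    have hm0 : 0 ≤ max (2 - x) 0 := le_max_right _ _
    have hm1 : max (2 - x) 0 ≤ |x - 2| := max_le (by rw [abs_sub_comm]; exact le_abs_self _) (abs_nonneg _)
    have hm2 : |x - 2| ≤ 1 := abs_le.2 ⟨by linarith [hx.1], by linarith [hx.2]⟩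
    simp only [this, smul_zero, sub_zero, zero_pow (show k+2 ≠ 0 by omega), one_mul, norm_pow, Real.norm_eq_abs,
      abs_of_nonneg hm0]
    calc max (2-x) 0 ^ (k+2) ≤ |x-2|^(k+2) := pow_le_pow_left₀ hm0 hm1 _
      _ ≤ |x-2|^2 := pow_le_pow_of_le_one (abs_nonneg _) hm2 (by omega)
  · rw [max_eq_right (by linarith), zero_pow (by omega), mul_zero]
    refine (hasDerivAt_const r (0:ℝ)).congr_of_eventuallyEq ?_
    filter_upwards [Ioi_mem_nhds h] with x hx
    rw [max_eq_right (by linarith [Set.mem_Ioi.1 hx]), zero_pow (by omega)]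

lemma kerP_deriv (r : ℝ) : HasDerivAt kerP (-(kerK r) * r) r := by
  have hp : HasDerivAt (fun r : ℝ => 3072 + 10752*r + 14848*r^2 + 8960*r^3 + 2880*r^4 + 490*r^5 + 35*r^6)
     (10752*1 + 14848*((2:ℕ) * r^1) + 8960*((3:ℕ)*r^2) + 2880*((4:ℕ)*r^3) + 490*((5:ℕ)*r^4) + 35*((6:ℕ)*r^5)) r :=
    ((((((((hasDerivAt_id' r).const_mul 10752).const_add 3072).add ((hasDerivAt_pow 2 r).const_mul 14848)).add
      ((hasDerivAt_pow 3 r).const_mul 8960)).add ((hasDerivAt_pow 4 r).const_mul 2880)).add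
      ((hasDerivAt_pow 5 r).const_mul 490)).add ((hasDerivAt_pow 6 r).const_mul 35))
  refine (((hasDerivAt_maxpow 5 r).mul hp).div_const 23063040).congr_deriv ?_
  unfold kerK
  rcases le_total (2 - r) 0 with h | h
  · rw [max_eq_right h]; norm_num
  · rw [max_eq_left h]; push_cast; ring

lemma kerK_deriv (r : ℝ) : HasDerivAt kerK (-(kerJ r) * r) r := by
  have hp : HasDerivAt (fun r : ℝ => 2048 + 6144*r + 5120*r^2 + 2060*r^3 + 420*r^4 + 35*r^5)
     (6144*1 + 5120*((2:ℕ) * r^1) + 2060*((3:ℕ)*r^2) + 420*((4:ℕ)*r^3) + 35*((5:ℕ)*r^4)) r :=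
    (((((((hasDerivAt_id' r).const_mul 6144).const_add 2048).add ((hasDerivAt_pow 2 r).const_mul 5120)).add
      ((hasDerivAt_pow 3 r).const_mul 2060)).add ((hasDerivAt_pow 4 r).const_mul 420)).add
      ((hasDerivAt_pow 5 r).const_mul 35))
  refine (((hasDerivAt_maxpow 4 r).mul hp).div_const 1774080).congr_deriv ?_
  unfold kerJ
  rcases le_total (2 - r) 0 with h | h
  · rw [max_eq_right h]; norm_num
  · rw [max_eq_left h]; push_cast; ring

lemma radial_fderiv (h : ℝ → ℝ) (h1 : ℝ → ℝ) (hh : ∀ r, HasDerivAt h (-(h1 r) * r) r) (v : E4) :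
    HasFDerivAt (fun w : E4 => h ‖w‖) (-(h1 ‖v‖) • innerSL ℝ v) v := by
  by_cases hv : v = 0
  · subst hv
    have h0 := hh 0
    simp only [norm_zero, mul_zero, map_zero, smul_zero] at h0 ⊢
    rw [hasDerivAt_iff_isLittleO] at h0
    rw [hasFDerivAt_iff_isLittleO]
    have ht : Filter.Tendsto (fun w : E4 => ‖w‖) (nhds 0) (nhds 0) := by
      simpa using (continuous_norm (E := E4)).tendsto 0
    have h2 := h0.comp_tendsto ht
    simp [Function.comp_def] at h2 ⊢
    exact h2.of_norm_right
  · have hn : HasFDerivAt (fun w : E4 => ‖w‖) (‖v‖⁻¹ • innerSL ℝ v) v := by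
      have hsq := (hasStrictFDerivAt_norm_sq v).hasFDerivAt
      have hv' : ‖v‖^2 ≠ 0 := by positivity
      have := hsq.sqrt hv'
      simp only [Real.sqrt_sq (norm_nonneg _)] at this
      refine this.congr_fderiv ?_
      have hv0 : ‖v‖ ≠ 0 := norm_ne_zero_iff.2 hv
      ext w
      simp [two_smul]
      field_simp
      ring
    have := (hh ‖v‖).comp_hasFDerivAt v hn
    refine this.congr_fderiv ?_
    have hv' : ‖v‖ ≠ 0 := norm_ne_zero_iff.2 hv
    ext w
    simp
    field_simp

lemma line_deriv (z a : E4) (e : ℝ) :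
    HasDerivAt (fun e : ℝ => kerP ‖z + e • a‖) (-(kerK ‖z + e • a‖) * ⟪z + e • a, a⟫) e := by
  have h1 : HasDerivAt (fun e : ℝ => z + e • a) a e := by
    simpa using ((hasDerivAt_id' e).smul_const a).const_add z
  have := (radial_fderiv kerP kerK kerP_deriv (z + e • a)).comp_hasDerivAt e h1
  exact this

lemma line_deriv2 (z a : E4) :
    HasDerivAt (fun e : ℝ => -(kerK ‖z + e • a‖) * ⟪z + e • a, a⟫)
      (kerJ ‖z‖ * ⟪z, a⟫^2 - kerK ‖z‖ * ⟪a, a⟫) 0 := by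
  have h1 : HasDerivAt (fun e : ℝ => z + e • a) a 0 := by
    simpa using ((hasDerivAt_id' (0:ℝ)).smul_const a).const_add z
  have h2 := (radial_fderiv kerK kerJ kerK_deriv (z + (0:ℝ) • a)).comp_hasDerivAt 0 h1
  have h3 := h1.inner ℝ (hasDerivAt_const (0:ℝ) a)
  refine (h2.neg.mul h3).congr_deriv ?_
  simp
  ring

lemma second_deriv_nonneg (F F' : ℝ → ℝ) (F2 : ℝ) (h0 : ∀ e, 0 ≤ F e) (hF0 : F 0 = 0)
    (h1 : ∀ e, HasDerivAt F (F' e) e) (hF1 : F' 0 = 0) (h2 : HasDerivAt F' F2 0) : 0 ≤ F2 := by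
  by_contra hneg
  push Not at hneg
  have hd : deriv F = F' := funext fun e => (h1 e).deriv
  have hmax := isLocalMax_of_deriv_deriv_neg (f := F) (x₀ := 0) (by rw [hd, h2.deriv]; exact hneg)
    (by rw [hd]; exact hF1) (h1 0).continuousAt
  have hz : F =ᶠ[nhds 0] fun _ => 0 := by
    filter_upwards [hmax] with x hx
    exact le_antisymm (hx.trans hF0.le) (h0 x)
  have := hz.deriv.deriv_eq
  rw [hd, h2.deriv] at this
  simp at this
  linarith

/-- curl-free positive definiteness -/
lemma curlfree_pd {ι : Type*} (s : Finset ι) (u x : ι → E4) :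
    0 ≤ ∑ i ∈ s, ∑ j ∈ s, (kerK ‖x i - x j‖ * ⟪u i, u j⟫ -
      kerJ ‖x i - x j‖ * (⟪x i - x j, u i⟫ * ⟪x i - x j, u j⟫)) := by
  let F : ℝ → ℝ := fun e => ∑ i ∈ s, ∑ j ∈ s, (kerP ‖(x i - x j) + e • (u i - u j)‖
    - kerP ‖(x i - x j) + e • u i‖ - kerP ‖(x i - x j) + e • (- u j)‖ + kerP ‖x i - x j‖)
  let F' : ℝ → ℝ := fun e => ∑ i ∈ s, ∑ j ∈ s,
    (-(kerK ‖(x i - x j) + e • (u i - u j)‖) * ⟪(x i - x j) + e • (u i - u j), u i - u j⟫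
    - -(kerK ‖(x i - x j) + e • u i‖) * ⟪(x i - x j) + e • u i, u i⟫
    - -(kerK ‖(x i - x j) + e • (-u j)‖) * ⟪(x i - x j) + e • (-u j), -u j⟫)
  have hnn : ∀ e, 0 ≤ F e := by
    intro e
    have h := kerP_pd (s ×ˢ (Finset.univ : Finset Bool)) (fun p => if p.2 then 1 else -1)
      (fun p => if p.2 then x p.1 + e • u p.1 else x p.1)
    refine h.trans_eq ?_
    simp only [F]
    rw [Finset.sum_product]
    refine Finset.sum_congr rfl fun i _ => ?_
    rw [Fintype.sum_bool, Finset.sum_product, Finset.sum_product, ← Finset.sum_add_distrib]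
    refine Finset.sum_congr rfl fun j _ => ?_
    simp
    have e1 : x i + e • u i - (x j + e • u j) = x i - x j + e • (u i - u j) := by module
    have e2 : x i + e • u i - x j = x i - x j + e • u i := by module
    have e3 : x i - (x j + e • u j) = x i - x j + -(e • u j) := by module
    rw [e1, e2, e3]
    ring
  have h := second_deriv_nonneg F F' (∑ i ∈ s, ∑ j ∈ s,
    ((kerJ ‖x i - x j‖ * ⟪x i - x j, u i - u j⟫^2 - kerK ‖x i - x j‖ * ⟪u i - u j, u i - u j⟫)
     - (kerJ ‖x i - x j‖ * ⟪x i - x j, u i⟫^2 - kerK ‖x i - x j‖ * ⟪u i, u i⟫)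
     - (kerJ ‖x i - x j‖ * ⟪x i - x j, -u j⟫^2 - kerK ‖x i - x j‖ * ⟪-u j, -u j⟫))) hnn
    (by simp [F]) (by
      intro e
      refine HasDerivAt.fun_sum fun i _ => HasDerivAt.fun_sum fun j _ => ?_
      exact (((line_deriv _ _ e).sub (line_deriv _ _ e)).sub (line_deriv _ _ e)).add_const _)
    (by
      simp only [F', zero_smul, add_zero]
      refine Finset.sum_eq_zero fun i _ => Finset.sum_eq_zero fun j _ => ?_
      rw [inner_sub_right, inner_neg_right]; ring)
    (by
      refine HasDerivAt.fun_sum fun i _ => HasDerivAt.fun_sum fun j _ => ?_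
      exact ((line_deriv2 _ _).sub (line_deriv2 _ _)).sub (line_deriv2 _ _))
  have e : (∑ i ∈ s, ∑ j ∈ s,
    ((kerJ ‖x i - x j‖ * ⟪x i - x j, u i - u j⟫^2 - kerK ‖x i - x j‖ * ⟪u i - u j, u i - u j⟫)
     - (kerJ ‖x i - x j‖ * ⟪x i - x j, u i⟫^2 - kerK ‖x i - x j‖ * ⟪u i, u i⟫)
     - (kerJ ‖x i - x j‖ * ⟪x i - x j, -u j⟫^2 - kerK ‖x i - x j‖ * ⟪-u j, -u j⟫)))
     = 2 * ∑ i ∈ s, ∑ j ∈ s, (kerK ‖x i - x j‖ * ⟪u i, u j⟫ -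
      kerJ ‖x i - x j‖ * (⟪x i - x j, u i⟫ * ⟪x i - x j, u j⟫)) := by
    simp_rw [Finset.mul_sum]
    refine Finset.sum_congr rfl fun i _ => Finset.sum_congr rfl fun j _ => ?_
    simp only [inner_sub_right (x i - x j) (u i) (u j), inner_sub_left (u i) (u j),
      inner_sub_right (u i) (u i) (u j), inner_sub_right (u j) (u i) (u j), inner_neg_right, inner_neg_left, real_inner_comm (u i) (u j)]
    ring
  rw [e] at h
  linarith

lemma kerJ_nonneg {r : ℝ} (hr : 0 ≤ r) : 0 ≤ kerJ r := by
  unfold kerJ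
  have : 0 ≤ max (2 - r) 0 := le_max_right _ _
  positivity

lemma kerK_nonneg {r : ℝ} (hr : 0 ≤ r) : 0 ≤ kerK r := by
  unfold kerK
  have : 0 ≤ max (2 - r) 0 := le_max_right _ _
  positivity

lemma kerJ_zero_of {r : ℝ} (hr : 2 ≤ r) : kerJ r = 0 := by
  simp [kerJ, max_eq_right (show 2 - r ≤ 0 by linarith)]

lemma kerK_zero_of {r : ℝ} (hr : 2 ≤ r) : kerK r = 0 := by
  simp [kerK, max_eq_right (show 2 - r ≤ 0 by linarith)]

lemma kerJ_le_one {r : ℝ} (hr : 0 ≤ r) : kerJ r ≤ 1 := by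
  rcases le_total 2 r with h | h
  · rw [kerJ_zero_of h]; norm_num
  · unfold kerJ
    rw [max_eq_left (by linarith)]
    have h1 : (2 - r)*(2048 + 2600*r + 1380*r^2 + 350*r^3 + 35*r^4) ≤ 10000 := by
      nlinarith [mul_nonneg hr hr, mul_nonneg (mul_nonneg hr hr) hr, mul_nonneg (mul_nonneg hr hr) (sub_nonneg.2 h),
        mul_nonneg hr (sub_nonneg.2 h), mul_nonneg (mul_nonneg (mul_nonneg hr hr) hr) (sub_nonneg.2 h), sq_nonneg (r-1), sq_nonneg (r^2-1),
        mul_nonneg (mul_nonneg (mul_nonneg hr hr) (mul_nonneg hr hr)) hr, mul_nonneg (mul_nonneg hr hr) (mul_nonneg hr hr)]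
    have h2 : (2 - r)^4 ≤ 16 := by
      have : (2-r)^4 ≤ 2^4 := pow_le_pow_left₀ (by linarith) (by linarith) 4
      linarith
    have h3 : 0 ≤ (2-r)^4 := by positivity
    have : (2 - r)^5*(2048 + 2600*r + 1380*r^2 + 350*r^3 + 35*r^4) ≤ 16*10000 := by
      calc _ = (2-r)^4 * ((2 - r)*(2048 + 2600*r + 1380*r^2 + 350*r^3 + 35*r^4)) := by ring
        _ ≤ (2-r)^4 * 10000 := by gcongr
        _ ≤ _ := by gcongr
    rw [div_le_one (by norm_num)]
    linarith

lemma kerK_anti {a b : ℝ} (ha : 0 ≤ a) (hab : a ≤ b) : kerK b ≤ kerK a := by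
  have : AntitoneOn kerK (Set.Ici 0) := by
    apply antitoneOn_of_deriv_nonpos (convex_Ici 0)
    · exact fun x _ => (kerK_deriv x).continuousAt.continuousWithinAt
    · exact fun x _ => (kerK_deriv x).differentiableAt.differentiableWithinAt
    · intro x hx
      rw [interior_Ici] at hx
      rw [(kerK_deriv x).deriv]
      have := kerJ_nonneg (le_of_lt hx)
      have hx : 0 < x := hx
      nlinarith
  exact this ha (ha.trans hab) hab

def nproj (V : Submodule ℝ E4) (v : E4) : E4 := v - V.starProjection v

lemma sum_proj_sq (V : Submodule ℝ E4) (hV : Module.finrank ℝ V = 2) :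
    ∑ a : Fin 4, ⟪V.starProjection (EuclideanSpace.basisFun (Fin 4) ℝ a),
      V.starProjection (EuclideanSpace.basisFun (Fin 4) ℝ a)⟫ = 2 := by
  have h1 := LinearMap.trace_eq_sum_inner (V.starProjection : E4 →ₗ[ℝ] E4) (EuclideanSpace.basisFun (Fin 4) ℝ)
  have h2 : LinearMap.IsProj V (V.starProjection : E4 →ₗ[ℝ] E4) := by
    constructor
    · intro x; exact V.starProjection_apply_mem x
    · intro x hx; exact Submodule.starProjection_eq_self_iff.2 hx
  rw [h2.trace, hV] at h1
  push_cast at h1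
  rw [h1]
  refine Finset.sum_congr rfl fun a _ => ?_
  rw [Submodule.inner_starProjection_left_eq_right]
  congr 1
  exact (Submodule.starProjection_eq_self_iff.2 (V.starProjection_apply_mem _))

lemma inner_nproj (V : Submodule ℝ E4) (v : E4) : ⟪v, nproj V v⟫ = ‖nproj V v‖^2 := by
  have h : ⟪V.starProjection v, v - V.starProjection v⟫ = 0 := by
    rw [real_inner_comm]
    exact V.starProjection_inner_eq_zero v _ (V.starProjection_apply_mem v)
  unfold nproj
  rw [← real_inner_self_eq_norm_sq, inner_sub_left (v) (V.starProjection v) (v - V.starProjection v), h, sub_zero]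

lemma plane_ineq {ι : Type*} (s : Finset ι) (m : ι → ℝ) (hm : ∀ i ∈ s, 0 ≤ m i) (x : ι → E4)
    (V : ι → Submodule ℝ E4) (hV : ∀ i, Module.finrank ℝ (V i) = 2) :
    ∑ i ∈ s, ∑ j ∈ s, m i * m j * (kerJ ‖x i - x j‖ * ‖x i - x j‖^2 - 2 * kerK ‖x i - x j‖)
     ≤ 3 * ∑ i ∈ s, ∑ j ∈ s, m i * m j * (kerJ ‖x i - x j‖ * ‖nproj (V i) (x i - x j)‖^2) := by
  let B := EuclideanSpace.basisFun (Fin 4) ℝ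
  have h1 : 0 ≤ ∑ a : Fin 4, ∑ i ∈ s, ∑ j ∈ s,
      (kerK ‖x i - x j‖ * ⟪m i • (V i).starProjection (B a), m j • (V j).starProjection (B a)⟫ -
      kerJ ‖x i - x j‖ * (⟪x i - x j, m i • (V i).starProjection (B a)⟫ *
        ⟪x i - x j, m j • (V j).starProjection (B a)⟫)) :=
    Finset.sum_nonneg fun a _ => curlfree_pd s (fun i => m i • (V i).starProjection (B a)) x
  rw [Finset.sum_comm] at h1
  have h2 : ∀ i ∈ s, (∑ a : Fin 4, ∑ j ∈ s,
      (kerK ‖x i - x j‖ * ⟪m i • (V i).starProjection (B a), m j • (V j).starProjection (B a)⟫ -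
      kerJ ‖x i - x j‖ * (⟪x i - x j, m i • (V i).starProjection (B a)⟫ *
        ⟪x i - x j, m j • (V j).starProjection (B a)⟫)))
      ≤ ∑ j ∈ s, m i * m j * (2 * kerK ‖x i - x j‖ - kerJ ‖x i - x j‖ * (‖x i - x j‖^2
         - 3/2 * (‖nproj (V i) (x i - x j)‖^2 + ‖nproj (V j) (x i - x j)‖^2))) := by
    intro i hi
    rw [Finset.sum_comm]
    refine Finset.sum_le_sum fun j hj => ?_
    generalize x i - x j = z
    have hK := kerK_nonneg (norm_nonneg z)
    have hJ := kerJ_nonneg (norm_nonneg z)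
    have hmm := mul_nonneg (hm i hi) (hm j hj)
    have t1 : ∑ a : Fin 4, ⟪(V i).starProjection (B a), (V j).starProjection (B a)⟫ ≤ 2 := by
      have hle : ∀ a : Fin 4, ⟪(V i).starProjection (B a), (V j).starProjection (B a)⟫ ≤
         (⟪(V i).starProjection (B a), (V i).starProjection (B a)⟫ +
          ⟪(V j).starProjection (B a), (V j).starProjection (B a)⟫)/2 := by
        intro a
        have := real_inner_self_nonneg (x := (V i).starProjection (B a) - (V j).starProjection (B a))
        rw [real_inner_sub_sub_self] at this
        linarith
      refine (Finset.sum_le_sum fun a _ => hle a).trans ?_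
      rw [← Finset.sum_div, Finset.sum_add_distrib, sum_proj_sq _ (hV i), sum_proj_sq _ (hV j)]
      norm_num
    have t2 : ∑ a : Fin 4, ⟪z, (V i).starProjection (B a)⟫ * ⟪z, (V j).starProjection (B a)⟫
        = ⟪(V i).starProjection z, (V j).starProjection z⟫ := by
      rw [← B.sum_inner_mul_inner]
      refine Finset.sum_congr rfl fun a _ => ?_
      rw [← Submodule.inner_starProjection_left_eq_right, ← Submodule.inner_starProjection_left_eq_right,
        real_inner_comm (B a) ((V j).starProjection z)]
    have t3 : ‖z‖^2 - 3/2 * (‖nproj (V i) z‖^2 + ‖nproj (V j) z‖^2) ≤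
        ⟪(V i).starProjection z, (V j).starProjection z⟫ := by
      have e1 : (V i).starProjection z = z - nproj (V i) z := by simp [nproj]
      have e2 : (V j).starProjection z = z - nproj (V j) z := by simp [nproj]
      rw [e1, e2, inner_sub_left, inner_sub_right, inner_sub_right, inner_nproj,
        real_inner_comm z (nproj (V i) z), inner_nproj, real_inner_self_eq_norm_sq]
      have := real_inner_self_nonneg (x := nproj (V i) z + nproj (V j) z)
      rw [real_inner_add_add_self, real_inner_self_eq_norm_sq, real_inner_self_eq_norm_sq] at this
      linarith
    have e : ∑ a : Fin 4, (kerK ‖z‖ * ⟪m i • (V i).starProjection (B a), m j • (V j).starProjection (B a)⟫ -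
      kerJ ‖z‖ * (⟪z, m i • (V i).starProjection (B a)⟫ *
        ⟪z, m j • (V j).starProjection (B a)⟫)) = m i * m j * (kerK ‖z‖ *
        ∑ a : Fin 4, ⟪(V i).starProjection (B a), (V j).starProjection (B a)⟫ - kerJ ‖z‖ *
        ∑ a : Fin 4, ⟪z, (V i).starProjection (B a)⟫ * ⟪z, (V j).starProjection (B a)⟫) := by
      rw [Finset.mul_sum, Finset.mul_sum, ← Finset.sum_sub_distrib, Finset.mul_sum]
      refine Finset.sum_congr rfl fun a _ => ?_
      simp only [inner_smul_left, inner_smul_right, RCLike.conj_to_real]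
      ring
    rw [e, t2]
    apply mul_le_mul_of_nonneg_left _ hmm
    nlinarith [mul_le_mul_of_nonneg_left t1 hK, mul_le_mul_of_nonneg_left t3 hJ]
  have h3 := h1.trans (Finset.sum_le_sum h2)
  have h4 : ∑ i ∈ s, ∑ j ∈ s, m i * m j * (kerJ ‖x i - x j‖ * ‖nproj (V j) (x i - x j)‖^2)
     = ∑ i ∈ s, ∑ j ∈ s, m i * m j * (kerJ ‖x i - x j‖ * ‖nproj (V i) (x i - x j)‖^2) := by
    rw [Finset.sum_comm]
    refine Finset.sum_congr rfl fun i _ => Finset.sum_congr rfl fun j _ => ?_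
    have : nproj (V i) (x j - x i) = - nproj (V i) (x i - x j) := by
      unfold nproj
      rw [← neg_sub (x i) (x j), map_neg]; abel
    rw [this, norm_neg, norm_sub_rev (x j)]
    ring
  have h5 : ∑ i ∈ s, ∑ j ∈ s, m i * m j * (2 * kerK ‖x i - x j‖ - kerJ ‖x i - x j‖ * (‖x i - x j‖^2
         - 3/2 * (‖nproj (V i) (x i - x j)‖^2 + ‖nproj (V j) (x i - x j)‖^2)))
     = 3/2 * ∑ i ∈ s, ∑ j ∈ s, m i * m j * (kerJ ‖x i - x j‖ * ‖nproj (V i) (x i - x j)‖^2)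
      + 3/2 * ∑ i ∈ s, ∑ j ∈ s, m i * m j * (kerJ ‖x i - x j‖ * ‖nproj (V j) (x i - x j)‖^2)
      - ∑ i ∈ s, ∑ j ∈ s, m i * m j * (kerJ ‖x i - x j‖ * ‖x i - x j‖^2 - 2 * kerK ‖x i - x j‖) := by
    simp_rw [Finset.mul_sum]
    simp_rw [← Finset.sum_add_distrib, ← Finset.sum_sub_distrib]
    refine Finset.sum_congr rfl fun i _ => Finset.sum_congr rfl fun j _ => by ring
  rw [h5, h4] at h3
  linarith

def energy {ι : Type*} (s : Finset ι) (m : ι → ℝ) (x : ι → E4) (t : ℝ) : ℝ :=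
  t⁻¹^2 * ∑ i ∈ s, ∑ j ∈ s, m i * m j * kerK (‖x i - x j‖ * t⁻¹)

lemma energy_deriv {ι : Type*} (s : Finset ι) (m : ι → ℝ) (x : ι → E4) (t : ℝ) (ht : 0 < t) :
    HasDerivAt (energy s m x) (t⁻¹^3 * ∑ i ∈ s, ∑ j ∈ s, m i * m j *
      (kerJ (‖x i - x j‖ * t⁻¹) * (‖x i - x j‖ * t⁻¹)^2 - 2 * kerK (‖x i - x j‖ * t⁻¹))) t := by
  have hi := hasDerivAt_inv ht.ne'
  have h1 : HasDerivAt (fun t : ℝ => ∑ i ∈ s, ∑ j ∈ s, m i * m j * kerK (‖x i - x j‖ * t⁻¹))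
    (∑ i ∈ s, ∑ j ∈ s, m i * m j * (-(kerJ (‖x i - x j‖ * t⁻¹)) * (‖x i - x j‖ * t⁻¹) *
      (‖x i - x j‖ * (-(t^2)⁻¹)))) t := by
    refine HasDerivAt.fun_sum fun i _ => HasDerivAt.fun_sum fun j _ => ?_
    refine HasDerivAt.const_mul _ ?_
    exact (kerK_deriv (‖x i - x j‖ * t⁻¹)).comp t (hi.const_mul _)
  refine ((hi.pow 2).mul h1).congr_deriv ?_
  simp only [Pi.pow_apply]
  simp_rw [Finset.mul_sum]
  simp_rw [← Finset.sum_add_distrib]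
  refine Finset.sum_congr rfl fun i _ => Finset.sum_congr rfl fun j _ => ?_
  generalize kerJ (‖x i - x j‖ * t⁻¹) = a
  generalize kerK (‖x i - x j‖ * t⁻¹) = b
  push_cast
  simp only [← inv_pow]
  ring

lemma energy_step {ι : Type*} (s : Finset ι) (m : ι → ℝ) (hm : ∀ i ∈ s, 0 ≤ m i) (x : ι → E4)
    (V : ι → Submodule ℝ E4) (hV : ∀ i, Module.finrank ℝ (V i) = 2) (t₀ : ℝ) (ht₀ : 0 < t₀) :
    energy s m x (2*t₀) ≤ energy s m x t₀ + 3 / t₀^4 * ∑ i ∈ s, ∑ j ∈ s,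
      if ‖x i - x j‖ < 4 * t₀ then m i * m j * ‖nproj (V i) (x i - x j)‖^2 else 0 := by
  set Q := ∑ i ∈ s, ∑ j ∈ s,
      if ‖x i - x j‖ < 4 * t₀ then m i * m j * ‖nproj (V i) (x i - x j)‖^2 else 0 with hQ
  have hQ0 : 0 ≤ Q := by
    refine Finset.sum_nonneg fun i hi => Finset.sum_nonneg fun j hj => ?_
    have := mul_nonneg (hm i hi) (hm j hj)
    split_ifs <;> positivity
  have hder : ∀ t ∈ Set.Icc t₀ (2*t₀), deriv (energy s m x) t ≤ 3 / t₀^5 * Q := by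
    intro t ht
    have htp : 0 < t := ht₀.trans_le ht.1
    rw [(energy_deriv s m x t htp).deriv]
    have h1 := plane_ineq s m hm (fun i => t⁻¹ • x i) V hV
    have hn : ∀ i j, ‖t⁻¹ • x i - t⁻¹ • x j‖ = ‖x i - x j‖ * t⁻¹ := by
      intro i j
      rw [← smul_sub, norm_smul, Real.norm_of_nonneg (by positivity), mul_comm]
    have hnp : ∀ i j, ‖nproj (V i) (t⁻¹ • x i - t⁻¹ • x j)‖ = ‖nproj (V i) (x i - x j)‖ * t⁻¹ := by
      intro i j
      unfold nproj
      rw [← smul_sub, map_smul, ← smul_sub, norm_smul, Real.norm_of_nonneg (by positivity), mul_comm]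
    simp only [hn, hnp] at h1
    have h2 : ∑ i ∈ s, ∑ j ∈ s, m i * m j *
        (kerJ (‖x i - x j‖ * t⁻¹) * (‖nproj (V i) (x i - x j)‖ * t⁻¹) ^ 2) ≤ t⁻¹^2 * Q := by
      rw [hQ]
      simp_rw [Finset.mul_sum]
      refine Finset.sum_le_sum fun i hi => Finset.sum_le_sum fun j hj => ?_
      have hmm := mul_nonneg (hm i hi) (hm j hj)
      split_ifs with hlt
      · have hj1 := kerJ_le_one (r := ‖x i - x j‖ * t⁻¹) (by positivity)
        calc _ ≤ m i * m j * (1 * (‖nproj (V i) (x i - x j)‖ * t⁻¹) ^ 2) := by gcongr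
          _ = _ := by ring
      · have : 2 ≤ ‖x i - x j‖ * t⁻¹ := by
          rw [← div_eq_mul_inv, le_div_iff₀ htp]
          linarith [ht.2]
        rw [kerJ_zero_of this]; simp
    calc _ ≤ t⁻¹^3 * (3 * (t⁻¹^2 * Q)) := by
          have := h1.trans (mul_le_mul_of_nonneg_left h2 (by norm_num : (0:ℝ) ≤ 3))
          gcongr
      _ = 3 / t^5 * Q := by field_simp
      _ ≤ 3 / t₀^5 * Q := by
          have := ht.1
          gcongr
  have h := Convex.image_sub_le_mul_sub_of_deriv_le (convex_Icc t₀ (2*t₀)) (f := energy s m x)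
    (fun t ht => (energy_deriv s m x t (ht₀.trans_le ht.1)).continuousAt.continuousWithinAt)
    (fun t ht => (energy_deriv s m x t (ht₀.trans_le (interior_subset ht).1)).differentiableAt.differentiableWithinAt)
    (fun t ht => hder t (interior_subset ht)) t₀ ⟨le_refl _, by linarith⟩ (2*t₀) ⟨by linarith, le_refl _⟩ (by linarith)
  have e : 3 / t₀^5 * Q * (2*t₀ - t₀) = 3 / t₀^4 * Q := by field_simp; ring
  rw [e] at h
  linarith

lemma sep_card (q : ℝ) : ∃ N : ℕ, 1 ≤ N ∧ ∀ a > (0:ℝ), ∀ (c : E4) (F : Finset E4),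
    (∀ p ∈ F, dist p c ≤ q * a) → (∀ p ∈ F, ∀ p' ∈ F, p ≠ p' → a ≤ dist p p') → F.card ≤ N := by
  have htb := (isCompact_closedBall (0:E4) q).totallyBounded
  rw [Metric.totallyBounded_iff] at htb
  obtain ⟨t, htf, ht⟩ := htb (1/2) (by norm_num)
  refine ⟨htf.toFinset.card + 1, by omega, fun a ha c F hF hsep => ?_⟩
  have hex : ∀ p ∈ F, ∃ y ∈ htf.toFinset, dist (a⁻¹ • (p - c)) y < 1/2 := by
    intro p hp
    have : a⁻¹ • (p - c) ∈ closedBall (0:E4) q := by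
      rw [mem_closedBall_zero_iff, norm_smul, ← dist_eq_norm, Real.norm_of_nonneg (by positivity), inv_mul_le_iff₀ ha,
        mul_comm]
      exact hF p hp
    have := ht this
    simp only [Set.mem_iUnion] at this
    obtain ⟨y, hy, hy2⟩ := this
    exact ⟨y, by simpa using hy, hy2⟩
  choose! f hf hf2 using hex
  have : F.card ≤ htf.toFinset.card := by
    apply Finset.card_le_card_of_injOn f (fun p hp => hf p hp)
    intro p hp p' hp' hpp
    by_contra hne
    have h1 := hf2 p hp
    have h2 := hf2 p' hp'
    rw [hpp] at h1
    have h3 : dist (a⁻¹ • (p - c)) (a⁻¹ • (p' - c)) < 1 := by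
      have := dist_triangle_right (a⁻¹ • (p - c)) (a⁻¹ • (p' - c)) (f p')
      linarith
    rw [dist_eq_norm, ← smul_sub, norm_smul, Real.norm_of_nonneg (by positivity), sub_sub_sub_cancel_right,
      inv_mul_lt_iff₀ ha, ← dist_eq_norm] at h3
    have := hsep p hp p' hp' hne
    linarith
  omega

/-- maximal separated nets -/
lemma net_exists (q : ℝ) (N : ℕ) (hN : ∀ a > (0:ℝ), ∀ (c : E4) (F : Finset E4),
    (∀ p ∈ F, dist p c ≤ q * a) → (∀ p ∈ F, ∀ p' ∈ F, p ≠ p' → a ≤ dist p p') → F.card ≤ N)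
    (a : ℝ) (ha : 0 < a) (c : E4) (A : Set E4) (hA : ∀ p ∈ A, dist p c ≤ q * a) :
    ∃ F : Finset E4, (∀ p ∈ F, p ∈ A) ∧ (∀ p ∈ F, ∀ p' ∈ F, p ≠ p' → a ≤ dist p p') ∧
      (∀ p ∈ A, ∃ y ∈ F, dist p y < a) ∧ F.card ≤ N := by
  classical
  let P : ℕ → Prop := fun n => ∃ F : Finset E4, (∀ p ∈ F, p ∈ A) ∧
    (∀ p ∈ F, ∀ p' ∈ F, p ≠ p' → a ≤ dist p p') ∧ F.card = n
  have hP0 : P 0 := ⟨∅, by simp, by simp, by simp⟩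
  have hle : ∀ n, P n → n ≤ N := by
    rintro n ⟨F, h1, h2, rfl⟩
    exact hN a ha c F (fun p hp => hA p (h1 p hp)) h2
  have hmax := Nat.findGreatest_spec (P := P) (Nat.zero_le N) hP0
  obtain ⟨F, h1, h2, h3⟩ := hmax
  refine ⟨F, h1, h2, ?_, by rw [h3]; exact Nat.findGreatest_le N⟩
  intro p hp
  by_contra hcon
  push Not at hcon
  have hpF : p ∉ F := fun h => by
    have := hcon p h
    rw [dist_self] at this
    linarith
  have hnew : P (F.card + 1) := by
    refine ⟨insert p F, ?_, ?_, Finset.card_insert_of_notMem hpF⟩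
    · intro y hy
      rcases Finset.mem_insert.1 hy with rfl | hy
      · exact hp
      · exact h1 y hy
    · intro y hy y' hy' hne
      rcases Finset.mem_insert.1 hy with h5 | h5 <;> rcases Finset.mem_insert.1 hy' with h6 | h6
      · exact absurd (h5.trans h6.symm) hne
      · rw [h5]; exact hcon _ h6
      · rw [h6, dist_comm]; exact hcon _ h5
      · exact h2 y h5 y' h6 hne
  have := Nat.le_findGreatest (hle _ hnew) hnew
  omega

lemma exists_plane : ∃ V : Submodule ℝ E4, Module.finrank ℝ V = 2 := by
  let B := EuclideanSpace.basisFun (Fin 4) ℝ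
  have hli : LinearIndependent ℝ (fun i : Fin 2 => B (Fin.castLE (by norm_num) i)) :=
    B.orthonormal.linearIndependent.comp _ (Fin.castLE_injective _)
  exact ⟨_, by simpa using finrank_span_eq_card hli⟩

lemma nproj_le_infDist (L : AffineSubspace ℝ E4) (hL : (L : Set E4).Nonempty) (x y : E4) :
    ‖nproj L.direction (x - y)‖ ≤ infDist x (L : Set E4) + infDist y (L : Set E4) := by
  have hc : IsClosed (L : Set E4) := AffineSubspace.closed_of_finiteDimensional L
  obtain ⟨p, hp, hp2⟩ := hc.exists_infDist_eq_dist hL x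
  obtain ⟨p', hp', hp2'⟩ := hc.exists_infDist_eq_dist hL y
  rw [hp2, hp2']
  have hd : p - p' ∈ L.direction := AffineSubspace.vsub_mem_direction hp hp'
  have h0 : L.direction.starProjection (p - p') = p - p' := Submodule.starProjection_eq_self_iff.2 hd
  have h1 : nproj L.direction (x - y) = nproj L.direction ((x - p) - (y - p')) := by
    unfold nproj
    have : x - y = (x - p - (y - p')) + (p - p') := by abel
    rw [this, map_add, h0]; abel
  have h2 : ∀ v, ‖nproj L.direction v‖ ≤ ‖v‖ := by
    intro v
    have h := inner_nproj L.direction v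
    have h' := real_inner_le_norm v (nproj L.direction v)
    by_contra hlt
    push Not at hlt
    nlinarith [norm_nonneg v, norm_nonneg (nproj L.direction v)]
  rw [h1, dist_eq_norm, dist_eq_norm]
  exact (h2 _).trans (norm_sub_le _ _)

lemma integral_diracs (s : Finset E4) (w : E4 → ℝ) (hw : ∀ p ∈ s, 0 ≤ w p) (f : E4 → ℝ) (c : E4) (R : ℝ) :
    ∫ y in ball c R, f y ∂(∑ p ∈ s, ENNReal.ofReal (w p) • Measure.dirac p)
      = ∑ p ∈ s, if ‖c - p‖ < R then w p * f p else 0 := by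
  classical
  rw [← integral_indicator measurableSet_ball, integral_finsetSum_measure]
  · refine Finset.sum_congr rfl fun p hp => ?_
    rw [integral_smul_measure, integral_dirac, ENNReal.toReal_ofReal (hw p hp)]
    simp [Set.indicator_apply, mem_ball, dist_eq_norm, norm_sub_rev p c]
  · intro p hp
    exact (integrable_dirac (by simp)).smul_measure (by simp)

lemma reif_plane (Z : Set E4) (hZ : Z ⊆ ball (0:E4) 2) (I : E4 → ℝ → ℝ) (C : ℝ)
    (h3 : ∀ μ : Measure E4, IsFiniteMeasure μ → μ Zᶜ = 0 →
    ∀ x ∈ closedBall (0:E4) (2 * 2), ∀ r ∈ Set.Ioc (0:ℝ) (2 * 2),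
      Dmu2 μ x r ≤ C / r ^ 2 * ∫ z in ball x r, (I z (32 * r) - I z (2 * r)) ∂μ)
    (s : Finset E4) (hs : ∀ p ∈ s, p ∈ Z) (m : E4 → ℝ) (hm : ∀ p ∈ s, 0 ≤ m p)
    (i : E4) (hi : i ∈ s) (R : ℝ) (hR : 0 < R) (hR4 : R ≤ 4) (ε : ℝ) (hε : 0 < ε) :
    ∃ V : Submodule ℝ E4, Module.finrank ℝ V = 2 ∧
      ∑ q ∈ s, (if ‖i - q‖ < R then m q * ‖nproj V (i - q)‖^2 else 0) ≤
       2 * C * R^2 * (∑ q ∈ s, (if ‖i - q‖ < R then m q * (I q (32*R) - I q (2*R)) else 0)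
        + (∑ q ∈ s, if ‖i - q‖ < R then m q else 0) * (I i (32*R) - I i (2*R))) + ε := by
  classical
  set S := ∑ q ∈ s, if ‖i - q‖ < R then m q else 0 with hS
  have hS0 : 0 ≤ S := Finset.sum_nonneg fun q hq => by
    split_ifs
    · exact hm q hq
    · exact le_refl _
  let w : E4 → ℝ := fun q => m q + if q = i then S else 0
  have hw : ∀ p ∈ s, 0 ≤ w p := by
    intro p hp
    have := hm p hp
    simp only [w]; split_ifs <;> positivity
  have hexp : ∀ f : E4 → ℝ, (∑ p ∈ s, if ‖i - p‖ < R then w p * f p else 0)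
      = (∑ p ∈ s, if ‖i - p‖ < R then m p * f p else 0) + S * f i := by
    intro f
    have : S * f i = ∑ p ∈ s, if p = i then S * f i else 0 := by
      rw [Finset.sum_ite_eq' s i]; simp [hi]
    rw [this, ← Finset.sum_add_distrib]
    refine Finset.sum_congr rfl fun p _ => ?_
    by_cases hpi : p = i
    · subst hpi; simp [w, hR]; ring
    · simp [w, hpi]
  let μ : Measure E4 := ∑ p ∈ s, ENNReal.ofReal (w p) • Measure.dirac p
  have hfin : IsFiniteMeasure μ := by
    constructor
    simp only [μ, Measure.coe_finsetSum, Finset.sum_apply, Measure.smul_apply, measure_univ, smul_eq_mul, mul_one]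
    exact ENNReal.sum_lt_top.2 fun p _ => ENNReal.ofReal_lt_top
  have hμZ : μ Zᶜ = 0 := by
    simp only [μ, Measure.coe_finsetSum, Finset.sum_apply, Measure.smul_apply, smul_eq_mul]
    refine Finset.sum_eq_zero fun p hp => ?_
    have : Measure.dirac p Zᶜ = 0 := by
      rw [Measure.dirac_apply]
      simp [hs p hp]
    rw [this, mul_zero]
  have hix : i ∈ closedBall (0:E4) (2*2) := by
    have := hZ (hs i hi)
    rw [mem_ball] at this
    rw [mem_closedBall]; linarith
  have h := h3 μ hfin hμZ i hix R ⟨hR, by linarith⟩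
  rw [integral_diracs s w hw, hexp (fun z => I z (32*R) - I z (2*R))] at h
  set ε' := ε / (2 * R^4) with hε'
  have hε'0 : 0 < ε' := by positivity
  have hlt : Dmu2 μ i R < Dmu2 μ i R + ε' := by linarith
  have hne : { s : ℝ | ∃ L : AffineSubspace ℝ E4, (L : Set E4).Nonempty ∧
    Module.finrank ℝ L.direction = 2 ∧
    s = R ^ (-4 : ℤ) * ∫ y in ball i R, (Metric.infDist y (L : Set E4)) ^ 2 ∂μ }.Nonempty := by
    obtain ⟨V, hV⟩ := exists_plane
    exact ⟨_, AffineSubspace.mk' 0 V, ⟨0, AffineSubspace.self_mem_mk' _ _⟩,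
      by rw [AffineSubspace.direction_mk']; exact hV, rfl⟩
  obtain ⟨d, ⟨L, hLne, hL2, rfl⟩, hd⟩ := exists_lt_of_csInf_lt hne hlt
  refine ⟨L.direction, hL2, ?_⟩
  rw [integral_diracs s w hw (fun y => infDist y (L : Set E4) ^ 2), hexp (fun y => infDist y (L : Set E4) ^ 2)] at hd
  have hb : ∑ q ∈ s, (if ‖i - q‖ < R then m q * ‖nproj L.direction (i - q)‖^2 else 0) ≤
      2 * ((∑ p ∈ s, if ‖i - p‖ < R then m p * infDist p (L : Set E4) ^ 2 else 0) + S * infDist i (L : Set E4) ^ 2) := by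
    rw [hS, Finset.sum_mul, ← Finset.sum_add_distrib, Finset.mul_sum]
    refine Finset.sum_le_sum fun q hq => ?_
    split_ifs with hq2
    · have h1 := nproj_le_infDist L hLne i q
      have h2 : ‖nproj L.direction (i - q)‖^2 ≤ 2 * (infDist q (L : Set E4) ^ 2 + infDist i (L : Set E4)^2) := by
        nlinarith [norm_nonneg (nproj L.direction (i - q)), sq_nonneg (infDist q (L : Set E4) - infDist i (L : Set E4)),
          infDist_nonneg (x := i) (s := (L : Set E4)), infDist_nonneg (x := q) (s := (L : Set E4))]
      nlinarith [mul_le_mul_of_nonneg_left h2 (hm q hq)]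
    · simp
  refine hb.trans ?_
  have hd2 := hd.le.trans (add_le_add_left h ε')
  have hR4' : R ^ (-4 : ℤ) = (R^4)⁻¹ := by
    rw [zpow_neg]; norm_cast
  rw [hR4', inv_mul_le_iff₀ (by positivity)] at hd2
  have e : R^4 * (C / R^2 * ((∑ p ∈ s, if ‖i - p‖ < R then m p * (I p (32 * R) - I p (2 * R)) else 0) +
          S * (I i (32 * R) - I i (2 * R))) + ε') = C * R^2 * ((∑ p ∈ s, if ‖i - p‖ < R then m p * (I p (32 * R) - I p (2 * R)) else 0) +
          S * (I i (32 * R) - I i (2 * R))) + ε/2 := by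
    rw [hε']; field_simp
  rw [e] at hd2
  linarith

/-- energy increment over one dyadic scale -/
lemma energy_step2 (Z : Set E4) (hZ : Z ⊆ ball (0:E4) 2) (I : E4 → ℝ → ℝ) (C : ℝ) (hC : 0 < C)
    (h3 : ∀ μ : Measure E4, IsFiniteMeasure μ → μ Zᶜ = 0 →
    ∀ x ∈ closedBall (0:E4) (2 * 2), ∀ r ∈ Set.Ioc (0:ℝ) (2 * 2),
      Dmu2 μ x r ≤ C / r ^ 2 * ∫ z in ball x r, (I z (32 * r) - I z (2 * r)) ∂μ)
    (s : Finset E4) (hs : ∀ p ∈ s, p ∈ Z) (m : E4 → ℝ) (hm : ∀ p ∈ s, 0 ≤ m p)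
    (t : ℝ) (ht : 0 < t) (ht1 : t ≤ 1) (Smax : ℝ)
    (hW : ∀ p ∈ s, 0 ≤ I p (128*t) - I p (8*t))
    (hS : ∀ p ∈ s, (∑ q ∈ s, if ‖p - q‖ < 4*t then m q else 0) ≤ Smax) :
    energy s m id (2*t) ≤ energy s m id t + 192 * C * Smax / t^2 *
      ∑ p ∈ s, m p * (I p (128*t) - I p (8*t)) := by
  apply le_of_forall_pos_le_add
  intro δ hδ
  set M := ∑ p ∈ s, m p with hM
  have hM0 : 0 ≤ M := Finset.sum_nonneg hm
  set ε := δ * t^4 / (3 * (M + 1)) with hε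
  have hε0 : 0 < ε := by positivity
  have hex : ∀ i : E4, ∃ V : Submodule ℝ E4, Module.finrank ℝ V = 2 ∧ (i ∈ s →
      ∑ q ∈ s, (if ‖i - q‖ < 4*t then m q * ‖nproj V (i - q)‖^2 else 0) ≤
       2 * C * (4*t)^2 * (∑ q ∈ s, (if ‖i - q‖ < 4*t then m q * (I q (32*(4*t)) - I q (2*(4*t))) else 0)
        + (∑ q ∈ s, if ‖i - q‖ < 4*t then m q else 0) * (I i (32*(4*t)) - I i (2*(4*t)))) + ε) := by
    intro i
    by_cases hi : i ∈ s
    · obtain ⟨V, h1, h2⟩ := reif_plane Z hZ I C h3 s hs m hm i hi (4*t) (by linarith) (by linarith) ε hε0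
      exact ⟨V, h1, fun _ => h2⟩
    · obtain ⟨V, h1⟩ := exists_plane
      exact ⟨V, h1, fun h => absurd h hi⟩
  choose V hV hV2 using hex
  have hst := energy_step s m hm id V hV t ht
  simp only [id] at hst
  have e32 : 32 * (4*t) = 128*t := by ring
  have e2 : 2 * (4*t) = 8*t := by ring
  simp only [e32, e2] at hV2
  set W : E4 → ℝ := fun p => I p (128*t) - I p (8*t) with hWd
  have hb : ∑ i ∈ s, ∑ j ∈ s, (if ‖i - j‖ < 4 * t then m i * m j * ‖nproj (V i) (i - j)‖^2 else 0)
      ≤ 64 * C * t^2 * Smax * ∑ p ∈ s, m p * W p + ε * M := by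
    have h1 : ∀ i ∈ s, ∑ j ∈ s, (if ‖i - j‖ < 4 * t then m i * m j * ‖nproj (V i) (i - j)‖^2 else 0)
      ≤ 32 * C * t^2 * (∑ q ∈ s, (if ‖i - q‖ < 4*t then m i * (m q * W q) else 0)) +
        32 * C * t^2 * (Smax * (m i * W i)) + ε * m i := by
      intro i hi
      have h2 := mul_le_mul_of_nonneg_left (hV2 i hi) (hm i hi)
      rw [Finset.mul_sum] at h2
      have e : ∑ j ∈ s, (if ‖i - j‖ < 4 * t then m i * m j * ‖nproj (V i) (i - j)‖^2 else 0) =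
        ∑ j ∈ s, m i * (if ‖i - j‖ < 4 * t then m j * ‖nproj (V i) (i - j)‖^2 else 0) := by
        refine Finset.sum_congr rfl fun j _ => ?_
        split_ifs <;> ring
      rw [e]
      refine h2.trans ?_
      have e' : ∑ q ∈ s, (if ‖i - q‖ < 4*t then m i * (m q * W q) else 0) =
         m i * ∑ q ∈ s, (if ‖i - q‖ < 4*t then (m q * W q) else 0) := by
        rw [Finset.mul_sum]
        refine Finset.sum_congr rfl fun j _ => ?_
        split_ifs <;> ring
      rw [e']
      have h4 := mul_le_mul_of_nonneg_right (hS i hi) (mul_nonneg (hm i hi) (hW i hi))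
      have h5 := mul_le_mul_of_nonneg_left h4 (show 0 ≤ 32 * C * t^2 by positivity)
      simp only [hWd] at h5 ⊢
      linarith
    refine (Finset.sum_le_sum h1).trans ?_
    rw [Finset.sum_add_distrib, Finset.sum_add_distrib, ← Finset.mul_sum, ← Finset.mul_sum, ← Finset.mul_sum, ← Finset.mul_sum]
    have h6 : ∑ i ∈ s, ∑ q ∈ s, (if ‖i - q‖ < 4*t then m i * (m q * W q) else 0) ≤ Smax * ∑ p ∈ s, m p * W p := by
      rw [Finset.sum_comm, Finset.mul_sum]
      refine Finset.sum_le_sum fun q hq => ?_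
      have e' : ∑ i ∈ s, (if ‖i - q‖ < 4*t then m i * (m q * W q) else 0) =
         (∑ i ∈ s, (if ‖q - i‖ < 4*t then m i else 0)) * (m q * W q) := by
        rw [Finset.sum_mul]
        refine Finset.sum_congr rfl fun j _ => ?_
        rw [norm_sub_rev]
        split_ifs <;> ring
      rw [e']
      exact mul_le_mul_of_nonneg_right (hS q hq) (mul_nonneg (hm q hq) (hW q hq))
    have h7 := mul_le_mul_of_nonneg_left h6 (show 0 ≤ 32 * C * t^2 by positivity)
    linarith
  have hb2 := mul_le_mul_of_nonneg_left hb (show 0 ≤ 3 / t^4 by positivity)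
  have e1 : 3 / t^4 * (64 * C * t^2 * Smax * ∑ p ∈ s, m p * W p + ε * M) =
      192 * C * Smax / t^2 * ∑ p ∈ s, m p * W p + δ * (M / (M+1)) := by
    rw [hε]; field_simp; ring
  rw [e1] at hb2
  have : M / (M+1) ≤ 1 := by rw [div_le_one (by linarith)]; linarith
  nlinarith

lemma sum_cover {α β : Type*} (B : Finset α) (F : Finset β) (G : β → Finset α) (m : α → ℝ)
    (hm : ∀ y, ∀ q ∈ G y, 0 ≤ m q) (hcov : ∀ q ∈ B, ∃ y ∈ F, q ∈ G y) :
    ∑ q ∈ B, m q ≤ ∑ y ∈ F, ∑ q ∈ G y, m q := by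
  classical
  have h1 : ∑ y ∈ F, ∑ q ∈ G y, m q ≥ ∑ y ∈ F, ∑ q ∈ B, if q ∈ G y then m q else 0 := by
    refine Finset.sum_le_sum fun y _ => ?_
    rw [← Finset.sum_filter]
    refine Finset.sum_le_sum_of_subset_of_nonneg ?_ ?_
    · intro q hq
      exact (Finset.mem_filter.1 hq).2
    · intro q hq _
      exact hm y q hq
  refine le_trans ?_ h1
  rw [Finset.sum_comm]
  refine Finset.sum_le_sum fun q hq => ?_
  obtain ⟨y, hy, hqy⟩ := hcov q hq
  have h := Finset.single_le_sum (f := fun y => if q ∈ G y then m q else 0) (s := F) (fun y' _ => by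
    split_ifs with h
    · exact hm y' q h
    · exact le_refl _) hy
  rw [if_pos hqy] at h
  exact h

lemma telescope4 (g : ℕ → ℝ) (Λ : ℝ) (k N : ℕ) (hkN : k ≤ N)
    (hmono : ∀ i j, i ≤ j → j ≤ N + 6 → g i ≤ g j) (hb : ∀ j, j ≤ N + 6 → g j ≤ Λ) :
    ∑ l ∈ Finset.range N, (if k < l + 1 then g (l+7) - g (l+3) else 0) ≤ 4 * (Λ - g (k+3)) := by
  have key : ∀ n, n ≤ N → ∑ l ∈ Finset.range n, (if k < l + 1 then g (l+7) - g (l+3) else 0) ≤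
     if k ≤ n then (g (n+6) + g (n+5) + g (n+4) + g (n+3)) - (g (k+6) + g (k+5) + g (k+4) + g (k+3)) else 0 := by
    intro n
    induction n with
    | zero =>
      intro _
      by_cases hk : k = 0
      · subst hk; simp
      · simp [hk]
    | succ n ih =>
      intro hn
      rw [Finset.sum_range_succ]
      have := ih (by omega)
      by_cases h1 : k ≤ n
      · rw [if_pos h1] at this
        rw [if_pos (by omega), if_pos (by omega)]
        have e1 : n + 1 + 6 = n + 7 := by ring
        have e2 : n + 1 + 5 = n + 6 := by ring
        have e3 : n + 1 + 4 = n + 5 := by ring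
        have e4 : n + 1 + 3 = n + 4 := by ring
        rw [e1, e2, e3, e4]
        linarith
      · rw [if_neg h1] at this
        rw [if_neg (show ¬ (k < n + 1) by omega)]
        by_cases h2 : k = n + 1
        · subst h2; rw [if_pos le_rfl]; linarith
        · rw [if_neg (by omega)]; linarith
  have h := key N le_rfl
  rw [if_pos hkN] at h
  have b1 := hb (N+6) (by omega)
  have b2 := hb (N+5) (by omega)
  have b3 := hb (N+4) (by omega)
  have b4 := hb (N+3) (by omega)
  have m1 := hmono (k+3) (k+6) (by omega) (by omega)
  have m2 := hmono (k+3) (k+5) (by omega) (by omega)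
  have m3 := hmono (k+3) (k+4) (by omega) (by omega)
  linarith

lemma energy_jump (B : Finset E4) (k : E4 → ℕ) (l : ℕ) (t : ℝ) (ht : 0 < t) (m : E4 → ℝ)
    (hm : ∀ p ∈ B, k p = l → m p = 4 * t^2)
    (hsep : ∀ p ∈ B, ∀ q ∈ B, p ≠ q → k p = l → 2 * t ≤ ‖p - q‖) :
    energy (B.filter (fun p => k p < l + 1)) m id t = energy (B.filter (fun p => k p < l)) m id t
      + 4 * kerK 0 * ∑ p ∈ B.filter (fun p => k p = l), m p := by
  classical
  have hzero : ∀ p ∈ B, ∀ q ∈ B, p ≠ q → (k p = l ∨ k q = l) → m p * m q * kerK (‖p - q‖ * t⁻¹) = 0 := by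
    intro p hp q hq hne h
    have : 2 * t ≤ ‖p - q‖ := by
      rcases h with h | h
      · exact hsep p hp q hq hne h
      · rw [norm_sub_rev]; exact hsep q hq p hp hne.symm h
    rw [kerK_zero_of, mul_zero]
    rw [← div_eq_mul_inv, le_div_iff₀ ht]; exact this
  unfold energy
  simp only [id]
  have hs : ∀ f : E4 → ℝ, ∑ p ∈ B.filter (fun p => k p < l + 1), f p =
      ∑ p ∈ B.filter (fun p => k p < l), f p + ∑ p ∈ B.filter (fun p => k p = l), f p := by
    intro f
    rw [← Finset.sum_union]
    · congr 1
      ext p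
      simp only [Finset.mem_filter, Finset.mem_union]
      constructor
      · rintro ⟨h1, h2⟩
        rcases Nat.lt_succ_iff_lt_or_eq.1 h2 with h | h
        · exact Or.inl ⟨h1, h⟩
        · exact Or.inr ⟨h1, h⟩
      · rintro (⟨h1, h2⟩ | ⟨h1, h2⟩)
        · exact ⟨h1, by omega⟩
        · exact ⟨h1, by omega⟩
    · rw [Finset.disjoint_left]
      intro p h1 h2
      have := (Finset.mem_filter.1 h1).2
      have := (Finset.mem_filter.1 h2).2
      omega
  rw [hs]
  have h1 : ∑ p ∈ B.filter (fun p => k p < l), ∑ j ∈ B.filter (fun p => k p < l + 1), m p * m j * kerK (‖p - j‖ * t⁻¹)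
     = ∑ p ∈ B.filter (fun p => k p < l), ∑ j ∈ B.filter (fun p => k p < l), m p * m j * kerK (‖p - j‖ * t⁻¹) := by
    refine Finset.sum_congr rfl fun p hp => ?_
    rw [hs]
    rw [Finset.sum_eq_zero (s := B.filter (fun p => k p = l)), add_zero]
    intro q hq
    rw [Finset.mem_filter] at hp hq
    refine hzero p hp.1 q hq.1 ?_ (Or.inr hq.2)
    rintro rfl
    omega
  have h2 : ∑ p ∈ B.filter (fun p => k p = l), ∑ j ∈ B.filter (fun p => k p < l + 1), m p * m j * kerK (‖p - j‖ * t⁻¹)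
     = ∑ p ∈ B.filter (fun p => k p = l), 4 * t^2 * kerK 0 * m p := by
    refine Finset.sum_congr rfl fun p hp => ?_
    rw [Finset.mem_filter] at hp
    rw [Finset.sum_eq_single p]
    · rw [sub_self, norm_zero, zero_mul]
      nth_rewrite 1 [hm p hp.1 hp.2]
      ring
    · intro q hq hne
      rw [Finset.mem_filter] at hq
      exact hzero p hp.1 q hq.1 hne.symm (Or.inl hp.2)
    · intro h
      exact absurd (Finset.mem_filter.2 ⟨hp.1, by omega⟩) h
  rw [h1, h2, ← Finset.mul_sum, mul_add]
  congr 1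
  field_simp

lemma energy_iter (Z : Set E4) (hZ : Z ⊆ ball (0:E4) 2) (I : E4 → ℝ → ℝ) (Λ C : ℝ) (hC : 0 < C)
    (hb : ∀ x ∈ Z, ∀ r ∈ Set.Ioc (0:ℝ) (128 * 2), 0 ≤ I x r ∧ I x r ≤ Λ)
    (hmono : ∀ x ∈ Z, ∀ r₁ ∈ Set.Ioc (0:ℝ) (128 * 2), ∀ r₂ ∈ Set.Ioc (0:ℝ) (128 * 2),
      r₁ ≤ r₂ → I x r₁ ≤ I x r₂)
    (h3 : ∀ μ : Measure E4, IsFiniteMeasure μ → μ Zᶜ = 0 →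
    ∀ x ∈ closedBall (0:E4) (2 * 2), ∀ r ∈ Set.Ioc (0:ℝ) (2 * 2),
      Dmu2 μ x r ≤ C / r ^ 2 * ∫ z in ball x r, (I z (32 * r) - I z (2 * r)) ∂μ)
    (B : Finset E4) (hB : ∀ p ∈ B, p ∈ Z) (k : E4 → ℕ) (σ : ℝ) (hσ : 0 < σ) (n : ℕ)
    (hn : σ * 2^(n+1) ≤ 1) (hk : ∀ p ∈ B, k p ≤ n)
    (hsep : ∀ p ∈ B, ∀ q ∈ B, p ≠ q → 2 * (σ * 2^(k p)) ≤ dist p q)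
    (η : ℝ) (hη : ∀ p ∈ B, Λ - η ≤ I p (8 * (σ * 2^(k p))))
    (A : ℝ) (hA : 0 ≤ A)
    (hS : ∀ l ≤ n + 1, ∀ p ∈ B, (∑ q ∈ B.filter (fun q => k q < l + 1),
      if ‖p - q‖ < 4 * (σ * 2^l) then 4 * (σ * 2^(k q))^2 else 0) ≤ A * (σ * 2^l)^2) :
    energy B (fun q => 4 * (σ * 2^(k q))^2) id (σ * 2^(n+2)) ≤
      (4 * kerK 0 + 768 * C * A * η) * ∑ q ∈ B, 4 * (σ * 2^(k q))^2 := by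
  classical
  set m : E4 → ℝ := fun q => 4 * (σ * 2^(k q))^2 with hm
  have hm0 : ∀ q, 0 ≤ m q := fun q => by simp only [hm]; positivity
  have hrange : ∀ j, j ≤ n + 8 → σ * 2^j ∈ Set.Ioc (0:ℝ) (128*2) := by
    intro j hj
    refine ⟨by positivity, ?_⟩
    calc σ * 2^j ≤ σ * 2^(n+8) := by
          gcongr
          norm_num
      _ = (σ * 2^(n+1)) * 128 := by ring
      _ ≤ 1 * 128 := by gcongr
      _ ≤ _ := by norm_num
  set W : E4 → ℕ → ℝ := fun p l => I p (128 * (σ * 2^l)) - I p (8 * (σ * 2^l)) with hWdef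
  have e128 : ∀ l, 128 * (σ * 2^l) = σ * 2^(l+7) := fun l => by ring
  have e8 : ∀ l, 8 * (σ * 2^l) = σ * 2^(l+3) := fun l => by ring
  have hW0 : ∀ p ∈ B, ∀ l ≤ n + 1, 0 ≤ W p l := by
    intro p hp l hl
    simp only [hWdef, e128, e8]
    have := hmono p (hB p hp) _ (hrange (l+3) (by omega)) _ (hrange (l+7) (by omega)) (by
      gcongr
      · norm_num
      · omega)
    linarith
  have key : ∀ l ≤ n + 2, energy (B.filter (fun q => k q < l)) m id (σ * 2^l) ≤
      4 * kerK 0 * ∑ q ∈ B.filter (fun q => k q < l), m q +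
        192 * C * A * ∑ l' ∈ Finset.range l, ∑ p ∈ B.filter (fun q => k q < l' + 1), m p * W p l' := by
    intro l
    induction l with
    | zero => intro _; simp [energy]
    | succ l ih =>
      intro hl
      have ih := ih (by omega)
      have ht : 0 < σ * 2^l := by positivity
      have ht1 : σ * 2^l ≤ 1 := by
        refine le_trans ?_ hn
        gcongr
        · norm_num
        · omega
      have hj := energy_jump B k l (σ * 2^l) ht m (by
        intro p _ h; simp only [hm, h]) (by
        intro p hp q hq hne h
        rw [← dist_eq_norm, ← h]
        exact hsep p hp q hq hne)
      have hst := energy_step2 Z hZ I C hC h3 (B.filter (fun q => k q < l + 1))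
        (fun p hp => hB p (Finset.mem_filter.1 hp).1) m (fun p _ => hm0 p) (σ * 2^l) ht ht1
        (A * (σ * 2^l)^2) (fun p hp => hW0 p (Finset.mem_filter.1 hp).1 l (by omega))
        (fun p hp => hS l (by omega) p (Finset.mem_filter.1 hp).1)
      have e1 : 2 * (σ * 2^l) = σ * 2^(l+1) := by ring
      have e2 : 192 * C * (A * (σ * 2^l)^2) / (σ * 2^l)^2 = 192 * C * A := by
        field_simp
      rw [e1, e2] at hst
      rw [Finset.sum_range_succ]
      have hsum : ∑ p ∈ B.filter (fun p => k p < l + 1), m p =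
          ∑ p ∈ B.filter (fun p => k p < l), m p + ∑ p ∈ B.filter (fun p => k p = l), m p := by
        simp only [Finset.sum_filter]
        rw [← Finset.sum_add_distrib]
        refine Finset.sum_congr rfl fun p _ => ?_
        rcases lt_trichotomy (k p) l with h | h | h
        · rw [if_pos (by omega), if_pos h, if_neg (by omega)]; ring
        · rw [if_pos (by omega), if_neg (by omega), if_pos h]; ring
        · rw [if_neg (by omega), if_neg (by omega), if_neg (by omega)]; ring
      rw [hsum]
      have : ∑ p ∈ B.filter (fun q => k q < l + 1), m p * W p l = ∑ p ∈ B.filter (fun q => k q < l + 1), m p * (I p (128 * (σ * 2^l)) - I p (8 * (σ * 2^l))) := rfl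
      rw [this]
      linarith
  have hfin := key (n+2) le_rfl
  have hBf : B.filter (fun q => k q < n + 2) = B := by
    apply Finset.filter_true_of_mem
    intro p hp
    have := hk p hp
    omega
  rw [hBf] at hfin
  have htel : ∑ l' ∈ Finset.range (n+2), ∑ p ∈ B.filter (fun q => k q < l' + 1), m p * W p l' ≤
      4 * η * ∑ q ∈ B, m q := by
    simp only [Finset.sum_filter]
    rw [Finset.sum_comm, Finset.mul_sum]
    refine Finset.sum_le_sum fun p hp => ?_
    have h := telescope4 (fun j => I p (σ * 2^j)) Λ (k p) (n+2) (by have := hk p hp; omega)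
      (fun i j hij hj => hmono p (hB p hp) _ (hrange i (by omega)) _ (hrange j (by omega)) (by
        gcongr
        · norm_num)) (fun j hj => (hb p (hB p hp) _ (hrange j (by omega))).2)
    have h8 := hη p hp
    rw [e8] at h8
    have e : ∑ x ∈ Finset.range (n+2), (if k p < x + 1 then m p * W p x else 0) =
        m p * ∑ l ∈ Finset.range (n+2), (if k p < l + 1 then I p (σ * 2^(l+7)) - I p (σ * 2^(l+3)) else 0) := by
      rw [Finset.mul_sum]
      refine Finset.sum_congr rfl fun l _ => ?_
      split_ifs
      · simp only [hWdef, e128, e8]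
      · ring
    rw [e]
    have hm0' := hm0 p
    calc _ ≤ m p * (4 * η) := by
          apply mul_le_mul_of_nonneg_left _ hm0'
          linarith
      _ = _ := by ring
  have := mul_le_mul_of_nonneg_left htel (show 0 ≤ 192 * C * A by positivity)
  calc _ ≤ _ := hfin
    _ ≤ 4 * kerK 0 * ∑ q ∈ B, m q + 192 * C * A * (4 * η * ∑ q ∈ B, m q) := by linarith
    _ = _ := by ring

lemma kerK_at_zero : kerK 0 = 256/3465 := by
  unfold kerK; norm_num

lemma kerK_at_one : kerK 1 = 2261/253440 := by
  unfold kerK; norm_num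

lemma packing_dyadic (Z : Set E4) (hZ : Z ⊆ ball (0:E4) 2) (I : E4 → ℝ → ℝ) (Λ C : ℝ) (hC : 0 < C)
    (hb : ∀ x ∈ Z, ∀ r ∈ Set.Ioc (0:ℝ) (128 * 2), 0 ≤ I x r ∧ I x r ≤ Λ)
    (hmono : ∀ x ∈ Z, ∀ r₁ ∈ Set.Ioc (0:ℝ) (128 * 2), ∀ r₂ ∈ Set.Ioc (0:ℝ) (128 * 2),
      r₁ ≤ r₂ → I x r₁ ≤ I x r₂)
    (h3 : ∀ μ : Measure E4, IsFiniteMeasure μ → μ Zᶜ = 0 →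
    ∀ x ∈ closedBall (0:E4) (2 * 2), ∀ r ∈ Set.Ioc (0:ℝ) (2 * 2),
      Dmu2 μ x r ≤ C / r ^ 2 * ∫ z in ball x r, (I z (32 * r) - I z (2 * r)) ∂μ) :
    ∃ K : ℝ, 1 ≤ K ∧ ∃ η > (0:ℝ), ∀ σ > (0:ℝ), ∀ (s : Finset E4) (k : E4 → ℕ),
      (∀ p ∈ s, p ∈ Z) → (∀ p ∈ s, ∀ q ∈ s, p ≠ q → 2 * (σ * 2^(k p)) ≤ dist p q) →
      (∀ p ∈ s, Λ - η ≤ I p (8 * (σ * 2^(k p)))) →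
      ∀ n : ℕ, 2 * (σ * 2^n) ≤ 1 → ∀ c : E4,
        ∑ p ∈ s.filter (fun p => k p ≤ n ∧ dist p c < 2 * (σ * 2^n)), 4 * (σ * 2^(k p))^2
          ≤ K * (2 * (σ * 2^n))^2 := by
  classical
  obtain ⟨N, hN1, hN⟩ := sep_card 2
  have hN1' : (1:ℝ) ≤ N := by exact_mod_cast hN1
  set K : ℝ := 32 * kerK 0 / kerK 1 with hKdef
  have hK : 1 ≤ K := by rw [hKdef, kerK_at_zero, kerK_at_one]; norm_num
  set A : ℝ := 8 * N * K with hAdef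
  have hA : 0 < A := by positivity
  have hk0 : 0 < kerK 0 := by rw [kerK_at_zero]; norm_num
  have hk1 : 0 < kerK 1 := by rw [kerK_at_one]; norm_num
  refine ⟨K, hK, 4 * kerK 0 / (768 * C * A), by positivity, ?_⟩
  intro σ hσ s k hs hsep hη n
  set m : E4 → ℝ := fun p => 4 * (σ * 2^(k p))^2 with hm
  have hm0 : ∀ q, 0 ≤ m q := fun q => by simp only [hm]; positivity
  induction n using Nat.strong_induction_on with
  | _ n IH =>
  intro hn c
  have hle1 : ∀ l, l ≤ n → 2 * (σ * 2^l) ≤ 1 := by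
    intro l hl
    refine le_trans ?_ hn
    gcongr
    · norm_num
  have hcov : ∀ l < n, ∀ p : E4, ∑ q ∈ s.filter (fun q => k q ≤ l ∧ dist q p < 2 * (2 * (σ * 2^l))), m q ≤
      N * K * (2 * (σ * 2^l))^2 := by
    intro l hl p
    obtain ⟨F, hF1, hF2, hF3, hF4⟩ := net_exists 2 N hN (2 * (σ * 2^l)) (by positivity) p
      {q | dist q p < 2 * (2 * (σ * 2^l))} (fun q hq => le_of_lt hq)
    calc _ ≤ ∑ y ∈ F, ∑ q ∈ s.filter (fun q => k q ≤ l ∧ dist q y < 2 * (σ * 2^l)), m q := by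
          refine sum_cover _ F (fun y => s.filter (fun q => k q ≤ l ∧ dist q y < 2 * (σ * 2^l))) m
            (fun _ q _ => hm0 q) ?_
          intro q hq
          rw [Finset.mem_filter] at hq
          obtain ⟨y, hy, hqy⟩ := hF3 q hq.2.2
          exact ⟨y, hy, Finset.mem_filter.2 ⟨hq.1, hq.2.1, hqy⟩⟩
      _ ≤ ∑ y ∈ F, K * (2 * (σ * 2^l))^2 := Finset.sum_le_sum fun y _ => IH l hl (hle1 l hl.le) y
      _ = F.card * (K * (2 * (σ * 2^l))^2) := by rw [Finset.sum_const, nsmul_eq_mul]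
      _ ≤ N * (K * (2 * (σ * 2^l))^2) := by
          apply mul_le_mul_of_nonneg_right _ (by positivity)
          exact_mod_cast hF4
      _ = _ := by ring
  set B := s.filter (fun p => k p ≤ n ∧ dist p c < 2 * (σ * 2^n)) with hBdef
  have hBmem : ∀ p ∈ B, p ∈ s ∧ k p ≤ n ∧ dist p c < 2 * (σ * 2^n) := fun p hp => Finset.mem_filter.1 hp
  set M := ∑ q ∈ B, m q with hM
  have hM0 : 0 ≤ M := Finset.sum_nonneg fun q _ => hm0 q
  have hMb : M ≤ A * (σ * 2^n)^2 := by
    have h1 : ∑ q ∈ B.filter (fun q => k q = n), m q ≤ N * K * (2 * (σ * 2^n))^2 := by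
      calc _ = ∑ q ∈ B.filter (fun q => k q = n), (2 * (σ * 2^n))^2 := by
            refine Finset.sum_congr rfl fun q hq => ?_
            simp only [hm, (Finset.mem_filter.1 hq).2]; ring
        _ = ((B.filter (fun q => k q = n)).card : ℝ) * (2 * (σ * 2^n))^2 := by rw [Finset.sum_const, nsmul_eq_mul]
        _ ≤ N * (2 * (σ * 2^n))^2 := by
            apply mul_le_mul_of_nonneg_right _ (by positivity)
            have := hN (2 * (σ * 2^n)) (by positivity) c (B.filter (fun q => k q = n)) (by
              intro p hp
              have := (hBmem p (Finset.mem_filter.1 hp).1).2.2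
              have h0 : 0 < 2 * (σ * 2^n) := by positivity
              linarith) (by
              intro p hp p' hp' hne
              have h1 := Finset.mem_filter.1 hp
              have h2 := Finset.mem_filter.1 hp'
              rw [← h1.2]
              exact hsep p (hBmem p h1.1).1 p' (hBmem p' h2.1).1 hne)
            exact_mod_cast this
        _ ≤ _ := by
            apply mul_le_mul_of_nonneg_right _ (by positivity)
            nlinarith
    have h2 : ∑ q ∈ B.filter (fun q => ¬ k q = n), m q ≤ N * K * (2 * (σ * 2^n))^2 := by
      rcases n with _ | n
      · rw [Finset.sum_eq_zero]
        · positivity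
        · intro q hq
          have h1 := Finset.mem_filter.1 hq
          have := (hBmem q h1.1).2.1
          omega
      · have h := hcov n (by omega) c
        have e : 2 * (2 * (σ * 2^n)) = 2 * (σ * 2^(n+1)) := by ring
        calc _ ≤ ∑ q ∈ s.filter (fun q => k q ≤ n ∧ dist q c < 2 * (2 * (σ * 2^n))), m q := by
              refine Finset.sum_le_sum_of_subset_of_nonneg ?_ (fun q _ _ => hm0 q)
              intro q hq
              have h1 := Finset.mem_filter.1 hq
              have h2 := hBmem q h1.1
              refine Finset.mem_filter.2 ⟨h2.1, by omega, ?_⟩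
              rw [e]; exact h2.2.2
          _ ≤ _ := h
          _ ≤ _ := by
              gcongr
              · norm_num
              · omega
    have := Finset.sum_filter_add_sum_filter_not B (fun q => k q = n) m
    rw [hM, ← this, hAdef]
    linarith
  have hS : ∀ l ≤ n + 1, ∀ p ∈ B, (∑ q ∈ B.filter (fun q => k q < l + 1),
      if ‖p - q‖ < 4 * (σ * 2^l) then m q else 0) ≤ A * (σ * 2^l)^2 := by
    intro l hl p hp
    by_cases hln : l < n
    · rw [← Finset.sum_filter]
      calc _ ≤ ∑ q ∈ s.filter (fun q => k q ≤ l ∧ dist q p < 2 * (2 * (σ * 2^l))), m q := by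
            refine Finset.sum_le_sum_of_subset_of_nonneg ?_ (fun q _ _ => hm0 q)
            intro q hq
            simp only [Finset.mem_filter] at hq ⊢
            refine ⟨(hBmem q hq.1.1).1, by omega, ?_⟩
            rw [dist_comm, dist_eq_norm]
            linarith [hq.2]
        _ ≤ _ := hcov l hln p
        _ ≤ _ := by
            rw [hAdef]
            have : 0 ≤ N * K * (σ * 2^l)^2 := by positivity
            nlinarith
    · calc _ ≤ ∑ q ∈ B.filter (fun q => k q < l + 1), m q := by
            refine Finset.sum_le_sum fun q _ => ?_
            split_ifs
            · exact le_rfl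
            · exact hm0 q
        _ ≤ M := Finset.sum_le_sum_of_subset_of_nonneg (Finset.filter_subset _ _) (fun q _ _ => hm0 q)
        _ ≤ _ := hMb
        _ ≤ _ := by
            gcongr
            · norm_num
            · omega
  have hE := energy_iter Z hZ I Λ C hC hb hmono h3 B (fun p hp => hs p (hBmem p hp).1) k σ hσ n
    (by calc σ * 2^(n+1) = 2 * (σ * 2^n) := by ring
          _ ≤ 1 := hn) (fun p hp => (hBmem p hp).2.1)
    (fun p hp q hq hne => hsep p (hBmem p hp).1 q (hBmem q hq).1 hne)
    (4 * kerK 0 / (768 * C * A)) (fun p hp => hη p (hBmem p hp).1) A hA.le hS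
  have e1 : 768 * C * A * (4 * kerK 0 / (768 * C * A)) = 4 * kerK 0 := by
    field_simp
  rw [e1] at hE
  set T := σ * 2^(n+2) with hT
  have hTpos : 0 < T := by positivity
  have hlow : T⁻¹^2 * (M * M * kerK 1) ≤ energy B m id T := by
    unfold energy
    apply mul_le_mul_of_nonneg_left _ (by positivity)
    rw [hM, Finset.sum_mul_sum, Finset.sum_mul]
    refine Finset.sum_le_sum fun p hp => ?_
    rw [Finset.sum_mul]
    refine Finset.sum_le_sum fun q hq => ?_
    apply mul_le_mul_of_nonneg_left _ (mul_nonneg (hm0 p) (hm0 q))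
    apply kerK_anti (by positivity)
    rw [← div_eq_mul_inv, div_le_one hTpos]
    simp only [id]
    rw [← dist_eq_norm]
    have h1 := (hBmem p hp).2.2
    have h2 := (hBmem q hq).2.2
    have h3 := dist_triangle_right p q c
    have : T = 4 * (σ * 2^n) := by rw [hT]; ring
    linarith
  have hfin : T⁻¹^2 * (M * M * kerK 1) ≤ (4 * kerK 0 + 4 * kerK 0) * M := hlow.trans hE
  have hT2 : (2 * (σ * 2^n))^2 * 4 = T^2 := by rw [hT]; ring
  by_cases hMz : M = 0
  · rw [hMz]; positivity
  have hMp : 0 < M := lt_of_le_of_ne hM0 (Ne.symm hMz)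
  have h5 : M * kerK 1 ≤ 8 * kerK 0 * T^2 := by
    rw [inv_pow, inv_mul_le_iff₀ (by positivity)] at hfin
    have : M * (M * kerK 1) ≤ M * (8 * kerK 0 * T^2) := by linarith
    exact le_of_mul_le_mul_left this hMp
  rw [hKdef, div_mul_eq_mul_div, le_div_iff₀ hk1]
  calc _ ≤ _ := h5
    _ = _ := by rw [← hT2]; ring

lemma vitali_levels (A : Set E4) (c : E4) (R : ℝ) (hA : ∀ z ∈ A, dist z c ≤ R)
    (ρ : ℕ → ℝ) (hρ : ∀ j, 0 < ρ j) (hanti : Antitone ρ) (k : E4 → ℕ) (L : ℕ) :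
    ∃ s : Finset E4, (∀ p ∈ s, p ∈ A ∧ k p < L) ∧
      (∀ p ∈ s, ∀ q ∈ s, p ≠ q → ρ (k p) ≤ dist p q) ∧
      (∀ z ∈ A, k z < L → ∃ p ∈ s, dist z p < ρ (k p)) := by
  classical
  induction L with
  | zero => exact ⟨∅, by simp, by simp, by intro z _ h; omega⟩
  | succ L ih =>
    obtain ⟨s, h1, h2, h3⟩ := ih
    obtain ⟨N, _, hN⟩ := sep_card (R / ρ L)
    obtain ⟨F, hF1, hF2, hF3, -⟩ := net_exists (R / ρ L) N hN (ρ L) (hρ L) c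
      {z | z ∈ A ∧ k z = L ∧ ∀ p ∈ s, ρ (k p) ≤ dist z p} (by
        intro z hz
        rw [div_mul_cancel₀ _ (hρ L).ne']
        exact hA z hz.1)
    refine ⟨s ∪ F, ?_, ?_, ?_⟩
    · intro p hp
      rcases Finset.mem_union.1 hp with h | h
      · exact ⟨(h1 p h).1, by have := (h1 p h).2; omega⟩
      · exact ⟨(hF1 p h).1, by have := (hF1 p h).2.1; omega⟩
    · intro p hp q hq hne
      rcases Finset.mem_union.1 hp with h | h <;> rcases Finset.mem_union.1 hq with h' | h'
      · exact h2 p h q h' hne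
      · rw [dist_comm]
        exact (hF1 q h').2.2 p h
      · refine le_trans (hanti ?_) ((hF1 p h).2.2 q h')
        have := (h1 q h').2
        have := (hF1 p h).2.1
        omega
      · rw [(hF1 p h).2.1]
        exact hF2 p h q h' hne
    · intro z hz hk
      by_cases hc : ∃ p ∈ s, dist z p < ρ (k p)
      · obtain ⟨p, hp, h⟩ := hc
        exact ⟨p, Finset.mem_union_left _ hp, h⟩
      · push Not at hc
        have hkz : k z = L := by
          by_contra hne
          obtain ⟨p, hp, h⟩ := h3 z hz (by omega)
          exact absurd h (not_lt.2 (hc p hp))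
        obtain ⟨y, hy, h⟩ := hF3 z ⟨hz, hkz, hc⟩
        refine ⟨y, Finset.mem_union_right _ hy, ?_⟩
        rw [(hF1 y hy).2.1]; exact h

def gram (u v : E4) : ℝ := ‖u‖^2 * ‖v‖^2 - ⟪u, v⟫^2

lemma gram_eq (u v : E4) (a b c d : ℝ) :
    gram (a • u + b • v) (c • u + d • v) = (a*d - b*c)^2 * gram u v := by
  unfold gram
  simp only [← real_inner_self_eq_norm_sq, inner_add_left, inner_add_right, real_inner_smul_left,
    real_inner_smul_right, real_inner_comm u v]
  ring

lemma height_le (p q r : E4) (b D G : ℝ) (hb : 0 < b) (hD : 0 < D) (hG : b^2 * D^2 ≤ gram (p - q) (r - q))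
    (hs : dist q r ≤ D) : b ≤ Metric.infDist p (line[ℝ, q, r] : Set E4) := by
  rw [Metric.le_infDist ⟨q, left_mem_affineSpan_pair ℝ q r⟩]
  intro y hy
  obtain ⟨t, rfl⟩ := mem_affineSpan_pair_iff_exists_lineMap_eq.1 hy
  rw [dist_eq_norm, AffineMap.lineMap_apply]
  have e : p - (t • (r -ᵥ q) +ᵥ q) = (1:ℝ) • (p - q) + (-t) • (r - q) := by
    simp only [vsub_eq_sub, vadd_eq_add, one_smul, neg_smul]
    abel
  rw [e]
  have e2 : r - q = (0:ℝ) • (p - q) + (1:ℝ) • (r - q) := by simp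
  have hg := gram_eq (p - q) (r - q) 1 (-t) 0 1
  rw [← e2] at hg
  have e3 : (1 * 1 - -t * 0 : ℝ)^2 = 1 := by ring
  rw [e3, one_mul] at hg
  rw [← hg] at hG
  generalize (1:ℝ) • (p - q) + (-t) • (r - q) = w at *
  unfold gram at hG
  rw [dist_comm, dist_eq_norm] at hs
  have h1 : b^2 * D^2 ≤ ‖w‖^2 * D^2 := by
    have : ‖r - q‖^2 ≤ D^2 := by gcongr
    nlinarith [sq_nonneg ⟪w, r - q⟫, sq_nonneg ‖w‖]
  have h2 : b^2 ≤ ‖w‖^2 := le_of_mul_le_mul_right h1 (by positivity)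
  exact le_of_sq_le_sq h2 (norm_nonneg w) |> fun h => h

lemma indep_of_gram (p : Fin 3 → E4) (b D : ℝ) (hb : 0 < b) (hD : 0 < D)
    (hG : b^2 * D^2 ≤ gram (p 2 - p 0) (p 1 - p 0)) (h01 : dist (p 0) (p 1) ≤ D)
    (h02 : dist (p 0) (p 2) ≤ D) (h12 : dist (p 1) (p 2) ≤ D) :
    ∀ j, b ≤ Metric.infDist (p j)
        ((affineSpan ℝ (p '' ({j}ᶜ)) : AffineSubspace ℝ E4) : Set E4) := by
  intro j
  have im0 : p '' ({0}ᶜ) = {p 1, p 2} := by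
    have : ({0}ᶜ : Set (Fin 3)) = {1, 2} := by ext i; fin_cases i <;> simp
    rw [this, Set.image_pair]
  have im1 : p '' ({1}ᶜ) = {p 0, p 2} := by
    have : ({1}ᶜ : Set (Fin 3)) = {0, 2} := by ext i; fin_cases i <;> simp
    rw [this, Set.image_pair]
  have im2 : p '' ({2}ᶜ) = {p 0, p 1} := by
    have : ({2}ᶜ : Set (Fin 3)) = {0, 1} := by ext i; fin_cases i <;> simp
    rw [this, Set.image_pair]
  fin_cases j
  · show b ≤ Metric.infDist (p 0) (affineSpan ℝ (p '' ({0}ᶜ)))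
    rw [im0]
    refine height_le _ _ _ b D 0 hb hD ?_ h12
    have := gram_eq (p 2 - p 0) (p 1 - p 0) 0 (-1) 1 (-1)
    have e1 : p 0 - p 1 = (0:ℝ) • (p 2 - p 0) + (-1:ℝ) • (p 1 - p 0) := by simp
    have e2 : p 2 - p 1 = (1:ℝ) • (p 2 - p 0) + (-1:ℝ) • (p 1 - p 0) := by simp
    rw [e1, e2, this]; norm_num; exact hG
  · show b ≤ Metric.infDist (p 1) (affineSpan ℝ (p '' ({1}ᶜ)))
    rw [im1]
    refine height_le _ _ _ b D 0 hb hD ?_ h02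
    have := gram_eq (p 2 - p 0) (p 1 - p 0) 0 1 1 0
    have e1 : p 1 - p 0 = (0:ℝ) • (p 2 - p 0) + (1:ℝ) • (p 1 - p 0) := by simp
    have e2 : p 2 - p 0 = (1:ℝ) • (p 2 - p 0) + (0:ℝ) • (p 1 - p 0) := by simp
    rw [← e1, ← e2] at this
    rw [this]; norm_num; exact hG
  · show b ≤ Metric.infDist (p 2) (affineSpan ℝ (p '' ({2}ᶜ)))
    rw [im2]
    exact height_le _ _ _ b D 0 hb hD hG h01

lemma line_near (H : Finset E4) (a : ℝ) (ha : 0 < a)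
    (hni : ¬ ∃ p : Fin 3 → E4, (∀ i, p i ∈ H) ∧ ∀ j, 2 * a ≤ Metric.infDist (p j)
        ((affineSpan ℝ (p '' ({j}ᶜ)) : AffineSubspace ℝ E4) : Set E4)) :
    ∃ u v : E4, ‖v‖ = 1 ∧ ∀ h ∈ H, ∃ t : ℝ, dist h (u + t • v) < 2 * a := by
  classical
  obtain ⟨e, he⟩ : ∃ e : E4, ‖e‖ = 1 := ⟨EuclideanSpace.single 0 1, by simp⟩
  by_cases hne : H.Nonempty
  swap
  · refine ⟨0, e, he, ?_⟩
    intro h hh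
    exact absurd ⟨h, hh⟩ hne
  obtain ⟨pq, hpq, hmax⟩ := Finset.exists_max_image (H ×ˢ H) (fun x => dist x.1 x.2) (hne.product hne)
  obtain ⟨u, w⟩ := pq
  rw [Finset.mem_product] at hpq
  have hmax' : ∀ x ∈ H, ∀ y ∈ H, dist x y ≤ dist u w := fun x hx y hy =>
    hmax (x, y) (Finset.mem_product.2 ⟨hx, hy⟩)
  by_cases hD : dist u w < 2 * a
  · refine ⟨u, e, he, fun h hh => ⟨0, ?_⟩⟩
    rw [zero_smul, add_zero]
    exact (hmax' h hh u hpq.1).trans_lt hD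
  push Not at hD
  have hDpos : 0 < dist u w := by linarith
  have hnD : ‖w - u‖ = dist u w := by rw [dist_comm, dist_eq_norm]
  refine ⟨u, (dist u w)⁻¹ • (w - u), ?_, ?_⟩
  · rw [norm_smul, hnD, norm_inv, Real.norm_of_nonneg hDpos.le, inv_mul_cancel₀ hDpos.ne']
  intro h hh
  have hg : gram (h - u) (w - u) < (2 * a)^2 * (dist u w)^2 := by
    by_contra hcon
    push Not at hcon
    apply hni
    refine ⟨![u, w, h], ?_, ?_⟩
    · intro i
      fin_cases i
      · exact hpq.1
      · exact hpq.2
      · exact hh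
    · refine indep_of_gram ![u, w, h] (2 * a) (dist u w) (by positivity) hDpos hcon le_rfl ?_ ?_
      · exact hmax' u hpq.1 h hh
      · exact hmax' w hpq.2 h hh
  generalize hd : dist u w = D at *
  refine ⟨D⁻¹ * ⟪h - u, w - u⟫, ?_⟩
  have hsq : dist h (u + (D⁻¹ * ⟪h - u, w - u⟫) • D⁻¹ • (w - u)) ^ 2 = gram (h - u) (w - u) / D^2 := by
    rw [dist_eq_norm, smul_smul, ← sub_sub, norm_sub_sq_real, norm_smul, real_inner_smul_right, hnD]
    unfold gram
    rw [hnD, Real.norm_eq_abs, mul_pow, sq_abs]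
    field_simp
    ring
  refine lt_of_pow_lt_pow_left₀ 2 (by positivity) ?_
  rw [hsq, div_lt_iff₀ (by positivity)]
  exact hg

lemma line_count : ∃ N₀ : ℕ, 1 ≤ N₀ ∧ ∀ (a : ℝ), 0 < a → ∀ (M : ℕ) (c u v : E4), ‖v‖ = 1 →
    ∀ F : Finset E4, (∀ p ∈ F, ∀ q ∈ F, p ≠ q → a / 2 ≤ dist p q) →
    (∀ p ∈ F, dist p c < M * a) → (∀ p ∈ F, ∃ t : ℝ, dist p (u + t • v) < 3 * a) →
    F.card ≤ N₀ * (2 * M + 1) := by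
  classical
  obtain ⟨N, hN1, hN⟩ := sep_card 20
  refine ⟨N, hN1, ?_⟩
  intro a ha M c u v hv F hsep hF hline
  set f : E4 → ℤ := fun p => ⌊⟪p - c, v⟫ / a⌋ with hf
  have hmaps : ∀ p ∈ F, f p ∈ Finset.Icc (-(M:ℤ)) M := by
    intro p hp
    have h1 : |⟪p - c, v⟫| ≤ ‖p - c‖ * ‖v‖ := abs_real_inner_le_norm _ _
    rw [hv, mul_one, ← dist_eq_norm] at h1
    have h2 := abs_le.1 (h1.trans (hF p hp).le)
    rw [Finset.mem_Icc]
    constructor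
    · simp only [hf]
      rw [Int.le_floor, le_div_iff₀ ha]
      push_cast
      linarith
    · simp only [hf]
      have : (⌊⟪p - c, v⟫ / a⌋ : ℝ) ≤ M := (Int.floor_le _).trans (by rw [div_le_iff₀ ha]; linarith)
      exact_mod_cast this
  have hcard := Finset.card_le_mul_card_image_of_maps_to (s := F) (t := Finset.Icc (-(M:ℤ)) M) (f := f) hmaps N ?_
  · refine hcard.trans (le_of_eq ?_)
    rw [Int.card_Icc]
    congr 1
    omega
  · intro i hi
    apply hN (a/2) (by positivity) (u + ((i:ℝ) * a - ⟪u - c, v⟫) • v)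
    · intro p hp
      rw [Finset.mem_filter] at hp
      obtain ⟨t, ht⟩ := hline p hp.1
      have h1 : (i:ℝ) ≤ ⟪p - c, v⟫ / a := by rw [← hp.2]; exact Int.floor_le _
      have h2 : ⟪p - c, v⟫ / a < i + 1 := by rw [← hp.2]; exact Int.lt_floor_add_one _
      rw [le_div_iff₀ ha] at h1
      rw [div_lt_iff₀ ha] at h2
      have h3 : |⟪p - (u + t • v), v⟫| < 3 * a := by
        have := abs_real_inner_le_norm (p - (u + t • v)) v
        rw [hv, mul_one, ← dist_eq_norm] at this
        exact this.trans_lt ht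
      have h4 : ⟪p - (u + t • v), v⟫ = ⟪p - c, v⟫ - ⟪u - c, v⟫ - t := by
        simp only [inner_sub_left, inner_add_left, real_inner_smul_left, real_inner_self_eq_norm_sq, hv]
        ring
      rw [h4, abs_lt] at h3
      have h5 : dist (u + t • v) (u + ((i:ℝ) * a - ⟪u - c, v⟫) • v) = |t - ((i:ℝ) * a - ⟪u - c, v⟫)| := by
        rw [dist_add_left, dist_eq_norm, ← sub_smul, norm_smul, hv, mul_one, Real.norm_eq_abs]
      have h6 : |t - ((i:ℝ) * a - ⟪u - c, v⟫)| ≤ 4 * a := by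
        rw [abs_le]; constructor <;> linarith
      have := dist_triangle p (u + t • v) (u + ((i:ℝ) * a - ⟪u - c, v⟫) • v)
      linarith
    · intro p hp q hq hne
      exact hsep p (Finset.mem_filter.1 hp).1 q (Finset.mem_filter.1 hq).1 hne

/-- `S` is covered by finitely many good balls of total cost at most `cost`. -/
def CovP (Good : E4 → ℝ → Prop) (S : Set E4) (cost : ℝ) : Prop :=
  ∃ l : List (E4 × ℝ), (∀ b ∈ l, Good b.1 b.2) ∧ (∀ z ∈ S, ∃ b ∈ l, dist z b.1 < b.2) ∧
    (l.map (fun b => b.2^2)).sum ≤ cost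

lemma CovP.single {Good : E4 → ℝ → Prop} {S : Set E4} {cost : ℝ} (c : E4) (ρ : ℝ) (hg : Good c ρ)
    (hS : ∀ z ∈ S, dist z c < ρ) (hc : ρ^2 ≤ cost) : CovP Good S cost :=
  ⟨[(c, ρ)], by simpa using hg, by simpa using hS, by simpa using hc⟩

lemma CovP.mono {Good : E4 → ℝ → Prop} {S : Set E4} {cost cost' : ℝ} (h : CovP Good S cost)
    (hc : cost ≤ cost') : CovP Good S cost' := by
  obtain ⟨l, h1, h2, h3⟩ := h
  exact ⟨l, h1, h2, h3.trans hc⟩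

lemma CovP.union {Good : E4 → ℝ → Prop} (F : Finset E4) (S : E4 → Set E4) (cost : E4 → ℝ)
    (h : ∀ y ∈ F, CovP Good (S y) (cost y)) :
    CovP Good {z | ∃ y ∈ F, z ∈ S y} (∑ y ∈ F, cost y) := by
  classical
  induction F using Finset.induction_on with
  | empty => exact ⟨[], by simp, by simp, by simp⟩
  | insert a F ha ih =>
    obtain ⟨l, h1, h2, h3⟩ := ih (fun y hy => h y (Finset.mem_insert_of_mem hy))
    obtain ⟨l', h1', h2', h3'⟩ := h a (Finset.mem_insert_self _ _)
    refine ⟨l' ++ l, ?_, ?_, ?_⟩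
    · intro b hb
      rcases List.mem_append.1 hb with hb | hb
      · exact h1' b hb
      · exact h1 b hb
    · rintro z ⟨y, hy, hz⟩
      rcases Finset.mem_insert.1 hy with rfl | hy
      · obtain ⟨b, hb, hd⟩ := h2' z hz
        exact ⟨b, List.mem_append_left _ hb, hd⟩
      · obtain ⟨b, hb, hd⟩ := h2 z ⟨y, hy, hz⟩
        exact ⟨b, List.mem_append_right _ hb, hd⟩
    · rw [List.map_append, List.sum_append, Finset.sum_insert ha]
      exact add_le_add h3' h3

lemma CovP.sub {Good : E4 → ℝ → Prop} {S S' : Set E4} {cost : ℝ} (h : CovP Good S cost)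
    (hs : ∀ z ∈ S', z ∈ S) : CovP Good S' cost := by
  obtain ⟨l, h1, h2, h3⟩ := h
  exact ⟨l, h1, fun z hz => h2 z (hs z hz), h3⟩

def GoodB (Z : Set E4) (I : E4 → ℝ → ℝ) (Λ δ lo s : ℝ) (c : E4) (ρ : ℝ) : Prop :=
  lo ≤ ρ ∧ (ρ ≤ s ∨ ∀ y ∈ Z, dist y c < ρ → I y (ρ / 20) < Λ - δ)

lemma bad_step (Z : Set E4) (hZ : Z ⊆ ball (0:E4) 2) (I : E4 → ℝ → ℝ) (Λ : ℝ)
    (epsFn : ℝ → ℝ → ℝ → ℝ)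
    (hb : ∀ x ∈ Z, ∀ r ∈ Set.Ioc (0:ℝ) (128 * 2), 0 ≤ I x r ∧ I x r ≤ Λ)
    (h2 : ∀ β ∈ Set.Ioo (0:ℝ) 1, ∀ β' ∈ Set.Ioo (0:ℝ) 1, ∀ τ > (0:ℝ),
    0 < epsFn β β' τ ∧
    ∀ x ∈ ball (0:E4) 2, ∀ r ∈ Set.Ioc (0:ℝ) 2, ∀ p : Fin 3 → E4,
      (∀ i, p i ∈ Z ∩ closedBall x r) →
      (∀ j, β' * r ≤ Metric.infDist (p j)
        ((affineSpan ℝ (p '' ({j}ᶜ)) : AffineSubspace ℝ E4) : Set E4)) →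
      (∀ i, I (p i) (2 * r) - I (p i) (β * r / 2) < epsFn β β' τ) →
      ∀ y ∈ Z ∩ closedBall x r, ∀ y' ∈ Z ∩ closedBall x r,
        |I y (β * r / 2) - I y' (β * r / 2)| < τ)
    (N₀ : ℕ) (hN₀ : ∀ (a : ℝ), 0 < a → ∀ (M : ℕ) (c u v : E4), ‖v‖ = 1 →
    ∀ F : Finset E4, (∀ p ∈ F, ∀ q ∈ F, p ≠ q → a / 2 ≤ dist p q) →
    (∀ p ∈ F, dist p c < M * a) → (∀ p ∈ F, ∃ t : ℝ, dist p (u + t • v) < 3 * a) →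
    F.card ≤ N₀ * (2 * M + 1))
    (lam : ℝ) (hlam : 0 < lam) (hlam1 : lam < 1) (M : ℕ) (hM : M * lam = 1)
    (N : ℕ) (hN : ∀ a > (0:ℝ), ∀ (c : E4) (F : Finset E4),
      (∀ p ∈ F, dist p c ≤ (2 * M) * a) → (∀ p ∈ F, ∀ p' ∈ F, p ≠ p' → a ≤ dist p p') → F.card ≤ N)
    (η δ : ℝ) (hη : 0 < η) (hδ : 0 < δ) (hδη : δ ≤ η / 2) (hδe : δ < epsFn (lam/20) lam (η/2))
    (s : ℝ) (hs : 0 < s) (Kc : ℝ) (hKc : 0 ≤ Kc)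
    (c : E4) (hc : c ∈ ball (0:E4) 2) (ρ : ℝ) (hρ : s < ρ) (hρ1 : ρ ≤ 1)
    (z : E4) (hz : z ∈ Z) (hzc : dist z c < ρ) (hzI : I z (lam * ρ / 20) < Λ - η)
    (hrec : ∀ y ∈ Z, CovP (GoodB Z I Λ δ (lam * s) s) (Z ∩ ball y (lam * ρ)) (Kc * (lam * ρ)^2)) :
    CovP (GoodB Z I Λ δ (lam * s) s) (Z ∩ ball c ρ) ((N * lam^2 + 3 * N₀ * lam * Kc) * ρ^2) := by
  classical
  have hρ0 : 0 < ρ := hs.trans hρ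
  set a := lam * ρ with ha
  have ha0 : 0 < a := by positivity
  have haρ : a < ρ := by rw [ha]; nlinarith
  have hMa : M * a = ρ := by rw [ha, ← mul_assoc, hM, one_mul]
  obtain ⟨F, hF1, hF2, hF3, hF4⟩ := net_exists (2 * M) N hN (a/2) (by positivity) c (Z ∩ ball c ρ) (by
    intro p hp
    have : dist p c < ρ := hp.2
    have e : 2 * M * (a/2) = M * a := by ring
    rw [e, hMa]; exact this.le)
  set P : E4 → Prop := fun y => ∃ h, h ∈ Z ∧ dist h y < a ∧ Λ - δ ≤ I h (a / 20) with hP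
  have hex : ∀ y, ∃ h, P y → (h ∈ Z ∧ dist h y < a ∧ Λ - δ ≤ I h (a / 20)) := by
    intro y
    by_cases hy : P y
    · obtain ⟨h, hh⟩ := hy
      exact ⟨h, fun _ => hh⟩
    · exact ⟨0, fun h => absurd h hy⟩
  choose h hh using hex
  -- number of recursive balls
  have hcard : (F.filter P).card ≤ N₀ * (2 * M + 1) := by
    have hHmem : ∀ q ∈ (F.filter P).image h, q ∈ Z ∩ closedBall c (2 * ρ) ∧ Λ - δ ≤ I q (a/20) := by
      intro q hq
      obtain ⟨y, hy, rfl⟩ := Finset.mem_image.1 hq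
      rw [Finset.mem_filter] at hy
      obtain ⟨g1, g2, g3⟩ := hh y hy.2
      refine ⟨⟨g1, ?_⟩, g3⟩
      rw [mem_closedBall]
      have h1 : dist y c < ρ := (hF1 y hy.1).2
      have := dist_triangle (h y) y c
      linarith
    have hni : ¬ ∃ p : Fin 3 → E4, (∀ i, p i ∈ (F.filter P).image h) ∧ ∀ j, 2 * a ≤ Metric.infDist (p j)
        ((affineSpan ℝ (p '' ({j}ᶜ)) : AffineSubspace ℝ E4) : Set E4) := by
      rintro ⟨p, hp, hind⟩
      obtain ⟨-, hpin⟩ := h2 (lam/20) ⟨by positivity, by linarith⟩ lam ⟨hlam, hlam1⟩ (η/2) (by positivity)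
      have e : lam / 20 * (2 * ρ) / 2 = a / 20 := by rw [ha]; ring
      have h5 := hpin c hc (2 * ρ) ⟨by positivity, by linarith⟩ p (fun i => (hHmem _ (hp i)).1)
        (fun j => by
          have := hind j
          have e' : lam * (2 * ρ) = 2 * a := by rw [ha]; ring
          rw [e']; exact this)
        (fun i => by
          rw [e]
          have g1 := (hHmem _ (hp i)).2
          have g2 := (hb (p i) (hHmem _ (hp i)).1.1 (2 * (2 * ρ)) ⟨by positivity, by linarith⟩).2
          linarith)
        z ⟨hz, by rw [mem_closedBall]; linarith⟩ (p 0) (hHmem _ (hp 0)).1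
      rw [e] at h5
      have g1 := (hHmem _ (hp 0)).2
      have g2 := (abs_lt.1 h5).1
      linarith
    obtain ⟨u, v, hv, hline⟩ := line_near _ a ha0 hni
    refine hN₀ a ha0 M c u v hv (F.filter P) ?_ ?_ ?_
    · intro p hp q hq hne
      exact hF2 p (Finset.mem_filter.1 hp).1 q (Finset.mem_filter.1 hq).1 hne
    · intro p hp
      rw [hMa]
      exact (hF1 p (Finset.mem_filter.1 hp).1).2
    · intro p hp
      obtain ⟨t, ht⟩ := hline (h p) (Finset.mem_image_of_mem h hp)
      refine ⟨t, ?_⟩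
      have g2 := (hh p (Finset.mem_filter.1 hp).2).2.1
      have := dist_triangle_left p (u + t • v) (h p)
      linarith
  have hu := CovP.union (Good := GoodB Z I Λ δ (lam * s) s) F (fun y => Z ∩ ball y a)
    (fun y => if P y then Kc * a^2 else a^2) (by
      intro y hy
      by_cases hPy : P y
      · rw [if_pos hPy]; exact hrec y (hF1 y hy).1
      · rw [if_neg hPy]
        refine CovP.single y a ⟨?_, Or.inr ?_⟩ (fun w hw => hw.2) le_rfl
        · rw [ha]; gcongr
        · intro w hw hd
          by_contra hcon
          push Not at hcon
          exact hPy ⟨w, hw, hd, hcon⟩)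
  refine (hu.sub ?_).mono ?_
  · intro w hw
    obtain ⟨y, hy, hd⟩ := hF3 w hw
    exact ⟨y, hy, hw.1, by rw [mem_ball]; linarith⟩
  · rw [Finset.sum_ite, Finset.sum_const, Finset.sum_const, nsmul_eq_mul, nsmul_eq_mul]
    have c1 : ((F.filter P).card : ℝ) ≤ N₀ * (2 * M + 1) := by exact_mod_cast hcard
    have c2 : ((F.filter (fun y => ¬ P y)).card : ℝ) ≤ N := by
      exact_mod_cast (Finset.card_filter_le _ _).trans hF4
    have c3 : (2 * (M:ℝ) + 1) * lam^2 ≤ 3 * lam := by nlinarith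
    calc _ ≤ (N₀ * (2 * M + 1) : ℝ) * (Kc * a^2) + N * a^2 := by gcongr
      _ = (N * lam^2 + N₀ * Kc * ((2 * (M:ℝ) + 1) * lam^2)) * ρ^2 := by rw [ha]; ring
      _ ≤ (N * lam^2 + N₀ * Kc * (3 * lam)) * ρ^2 := by gcongr
      _ = _ := by ring

lemma packing_lambda (Z : Set E4) (I : E4 → ℝ → ℝ) (Λ K η : ℝ)
    (hp : ∀ σ > (0:ℝ), ∀ (s : Finset E4) (k : E4 → ℕ),
      (∀ p ∈ s, p ∈ Z) → (∀ p ∈ s, ∀ q ∈ s, p ≠ q → 2 * (σ * 2^(k p)) ≤ dist p q) →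
      (∀ p ∈ s, Λ - η ≤ I p (8 * (σ * 2^(k p)))) →
      ∀ n : ℕ, 2 * (σ * 2^n) ≤ 1 → ∀ c : E4,
        ∑ p ∈ s.filter (fun p => k p ≤ n ∧ dist p c < 2 * (σ * 2^n)), 4 * (σ * 2^(k p))^2
          ≤ K * (2 * (σ * 2^n))^2)
    (m : ℕ) (lam : ℝ) (hlam : lam = (1/2)^m) (r : ℝ) (hr : 0 < r) (hr1 : r ≤ 1) (c : E4)
    (s : Finset E4) (k : E4 → ℕ) (L : ℕ) (hs : ∀ p ∈ s, p ∈ Z ∧ dist p c < r ∧ k p ≤ L)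
    (hsep : ∀ p ∈ s, ∀ q ∈ s, p ≠ q → r * lam^(k p) ≤ dist p q)
    (hI : ∀ p ∈ s, Λ - η ≤ I p (4 * (r * lam^(k p)))) :
    ∑ p ∈ s, (r * lam^(k p))^2 ≤ K * r^2 := by
  classical
  have hl0 : 0 < lam := by rw [hlam]; positivity
  have hkey : ∀ j ≤ L, 2 * (r / 2 * lam^L * 2^(m * (L - j))) = r * lam^j := by
    intro j hj
    obtain ⟨i, rfl⟩ := Nat.exists_eq_add_of_le hj
    have : lam^i * 2^(m * i) = 1 := by
      rw [pow_mul, ← mul_pow, hlam, ← mul_pow]; norm_num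
    rw [Nat.add_sub_cancel_left, pow_add]
    calc _ = r * lam^j * (lam^i * 2^(m*i)) := by ring
      _ = _ := by rw [this, mul_one]
  have h0 := hkey 0 (Nat.zero_le _)
  rw [pow_zero, mul_one, Nat.sub_zero] at h0
  have h := hp (r / 2 * lam^L) (by positivity) s (fun p => m * (L - k p)) (fun p hp => (hs p hp).1)
    (fun p hp q hq hne => by
      rw [hkey _ (hs p hp).2.2]; exact hsep p hp q hq hne)
    (fun p hp => by
      have e := hkey _ (hs p hp).2.2
      have e2 : 8 * (r / 2 * lam^L * 2^(m * (L - k p))) = 4 * (r * lam^(k p)) := by rw [← e]; ring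
      rw [e2]; exact hI p hp)
    (m * L) (by rw [h0]; exact hr1) c
  rw [h0] at h
  rw [Finset.filter_true_of_mem] at h
  · refine le_trans (le_of_eq ?_) h
    refine Finset.sum_congr rfl fun p hp => ?_
    rw [← hkey _ (hs p hp).2.2]; ring
  · intro p hp
    exact ⟨Nat.mul_le_mul_left _ (Nat.sub_le _ _), (hs p hp).2.1⟩

lemma cov_rec (Z : Set E4) (hZ : Z ⊆ ball (0:E4) 2) (I : E4 → ℝ → ℝ) (Λ K η δ lam s A Bc Kc : ℝ)
    (hmono : ∀ x ∈ Z, ∀ r₁ ∈ Set.Ioc (0:ℝ) (128 * 2), ∀ r₂ ∈ Set.Ioc (0:ℝ) (128 * 2),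
      r₁ ≤ r₂ → I x r₁ ≤ I x r₂)
    (hlam : 0 < lam) (hlam1 : lam < 1) (hs : 0 < s) (hA : 0 ≤ A) (hBc : 0 ≤ Bc) (hK : 1 ≤ K)
    (hKc1 : 1 ≤ Kc) (hKc : K * (1 + A + Bc * Kc) ≤ Kc)
    (hpack : ∀ (r : ℝ), 0 < r → r ≤ 1 → ∀ (c : E4)
      (s : Finset E4) (k : E4 → ℕ) (L : ℕ), (∀ p ∈ s, p ∈ Z ∧ dist p c < r ∧ k p ≤ L) →
      (∀ p ∈ s, ∀ q ∈ s, p ≠ q → r * lam^(k p) ≤ dist p q) →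
      (∀ p ∈ s, Λ - η ≤ I p (4 * (r * lam^(k p)))) →
      ∑ p ∈ s, (r * lam^(k p))^2 ≤ K * r^2)
    (hbad : ∀ (c : E4), c ∈ ball (0:E4) 2 → ∀ (ρ : ℝ), s < ρ → ρ ≤ 1 →
      ∀ (z : E4), z ∈ Z → dist z c < ρ → I z (lam * ρ / 20) < Λ - η →
      (∀ y ∈ Z, CovP (GoodB Z I Λ δ (lam * s) s) (Z ∩ ball y (lam * ρ)) (Kc * (lam * ρ)^2)) →
      CovP (GoodB Z I Λ δ (lam * s) s) (Z ∩ ball c ρ) ((A + Bc * Kc) * ρ^2)) :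
    ∀ (n : ℕ) (c : E4), c ∈ ball (0:E4) 2 → ∀ r, lam * s ≤ r → r ≤ 1 → r * lam^n ≤ s →
      CovP (GoodB Z I Λ δ (lam * s) s) (Z ∩ ball c r) (Kc * r^2) := by
  classical
  have hsingle : ∀ (c : E4) (r : ℝ), lam * s ≤ r → r ≤ s →
      CovP (GoodB Z I Λ δ (lam * s) s) (Z ∩ ball c r) (r^2) := by
    intro c r h1 h2
    exact CovP.single c r ⟨h1, Or.inl h2⟩ (fun w hw => hw.2) le_rfl
  intro n
  induction n with
  | zero =>
    intro c _ r h1 _ h3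
    rw [pow_zero, mul_one] at h3
    refine (hsingle c r h1 h3).mono ?_
    nlinarith [sq_nonneg r]
  | succ n ih =>
    intro c hc r h1 hr1 h3
    by_cases hrs : r ≤ s
    · refine (hsingle c r h1 hrs).mono ?_
      nlinarith [sq_nonneg r]
    push Not at hrs
    have hr0 : 0 < r := hs.trans hrs
    -- the recursion hypothesis for balls of radius `lam * ρ`
    have hrec : ∀ ρ, s < ρ → ρ ≤ r → ∀ y ∈ Z,
        CovP (GoodB Z I Λ δ (lam * s) s) (Z ∩ ball y (lam * ρ)) (Kc * (lam * ρ)^2) := by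
      intro ρ hρ hρr y hy
      have hρ0 : 0 < ρ := hs.trans hρ
      refine ih y (hZ hy) _ (by gcongr) (by nlinarith) ?_
      refine le_trans ?_ h3
      calc lam * ρ * lam^n = ρ * lam^(n+1) := by ring
        _ ≤ _ := by gcongr
    by_cases hbz : ∃ z ∈ Z, dist z c < r ∧ I z (lam * r / 20) < Λ - η
    · obtain ⟨z, hz, hzc, hzI⟩ := hbz
      refine (hbad c hc r hrs hr1 z hz hzc hzI (hrec r hrs le_rfl)).mono ?_
      have : A + Bc * Kc ≤ Kc := by
        have : 0 ≤ A + Bc * Kc := by positivity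
        nlinarith
      gcongr
    push Not at hbz
    set halted : E4 → ℕ → Prop := fun z k => r * lam^k ≤ s ∨ I z (lam * (r * lam^k) / 20) < Λ - η with hhalted
    have hex : ∀ z, ∃ k, halted z k := fun z => ⟨n+1, Or.inl h3⟩
    set k : E4 → ℕ := fun z => Nat.find (hex z) with hk
    have hkL : ∀ z, k z ≤ n + 1 := fun z => Nat.find_min' (hex z) (Or.inl h3)
    have hkst : ∀ z, halted z (k z) := fun z => Nat.find_spec (hex z)
    have hkmin : ∀ z j, j < k z → ¬ halted z j := fun z j hj => Nat.find_min (hex z) hj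
    have hk1 : ∀ z ∈ Z ∩ ball c r, 1 ≤ k z := by
      intro z hz
      by_contra hcon
      have h0 : k z = 0 := by omega
      have hst := hkst z
      rw [h0] at hst
      rcases hst with h | h
      · rw [pow_zero, mul_one] at h; linarith
      · rw [pow_zero, mul_one] at h
        have := hbz z hz.1 hz.2
        linarith
    have hprev : ∀ z ∈ Z ∩ ball c r, s * lam < r * lam^(k z) ∧ Λ - η ≤ I z (r * lam^(k z) / 20) := by
      intro z hz
      obtain ⟨j, hj⟩ : ∃ j, k z = j + 1 := ⟨k z - 1, by have := hk1 z hz; omega⟩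
      have := hkmin z j (by omega)
      simp only [hhalted] at this
      push Not at this
      rw [hj, pow_succ]
      constructor
      · nlinarith [this.1]
      · have e : r * (lam^j * lam) / 20 = lam * (r * lam^j) / 20 := by ring
        rw [e]; exact this.2
    obtain ⟨F, hF1, hF2, hF3⟩ := vitali_levels (Z ∩ ball c r) c r (fun z hz => le_of_lt hz.2)
      (fun j => r * lam^j) (fun j => by positivity)
      (fun i j hij => mul_le_mul_of_nonneg_left (pow_le_pow_of_le_one hlam.le hlam1.le hij) hr0.le) k (n+2)
    have hle : ∀ z, r * lam^(k z) ≤ r := fun z => by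
      have : lam^(k z) ≤ 1 := pow_le_one₀ hlam.le hlam1.le
      nlinarith
    have hpk := hpack r hr0 hr1 c F k (n+1) (fun p hp => ⟨(hF1 p hp).1.1, (hF1 p hp).1.2, hkL p⟩) hF2
      (fun p hp => by
        refine (hprev p (hF1 p hp).1).2.trans ?_
        have h0 : 0 < r * lam^(k p) := by positivity
        have h1 := hle p
        exact hmono p (hF1 p hp).1.1 _ ⟨by positivity, by linarith⟩ _ ⟨by positivity, by linarith⟩ (by linarith))
    have hu := CovP.union (Good := GoodB Z I Λ δ (lam * s) s) F (fun y => Z ∩ ball y (r * lam^(k y)))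
      (fun y => (1 + A + Bc * Kc) * (r * lam^(k y))^2) (by
        intro y hy
        have hyA := (hF1 y hy).1
        have hpos : 0 < r * lam^(k y) := by positivity
        have hAB : 0 ≤ A + Bc * Kc := by positivity
        by_cases hys : r * lam^(k y) ≤ s
        · refine (hsingle y _ ?_ hys).mono ?_
          · have := (hprev y hyA).1
            linarith
          · nlinarith [sq_nonneg (r * lam^(k y))]
        · push Not at hys
          have hst : I y (lam * (r * lam^(k y)) / 20) < Λ - η := by
            rcases hkst y with h | h
            · linarith
            · exact h
          refine (hbad y (hZ hyA.1) _ hys ((hle y).trans hr1) y hyA.1 (by rw [dist_self]; exact hpos) hst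
            (hrec _ hys (hle y))).mono ?_
          nlinarith [sq_nonneg (r * lam^(k y))])
    refine (hu.sub ?_).mono ?_
    · intro z hz
      obtain ⟨p, hp, hd⟩ := hF3 z hz (by have := hkL z; omega)
      exact ⟨p, hp, hz.1, hd⟩
    · rw [← Finset.mul_sum]
      have hAB : 0 ≤ 1 + A + Bc * Kc := by positivity
      calc _ ≤ (1 + A + Bc * Kc) * (K * r^2) := by gcongr
        _ = (K * (1 + A + Bc * Kc)) * r^2 := by ring
        _ ≤ _ := by gcongr

/-- Covering lemma (Lemma 9.6 of the paper): strongly `s`-admissible split-coverings exist. -/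
theorem stmt_6 (Z : Set E4) (hZm : MeasurableSet Z) (hZ : Z ⊆ ball (0:E4) 2)
    (I : E4 → ℝ → ℝ) (Λ : ℝ) (epsFn : ℝ → ℝ → ℝ → ℝ) (C : ℝ)
    (hI : IsTamingFunctionWith 2 Z I Λ epsFn C) :
    ∃ K₄ > (1:ℝ), ∃ β' ∈ Set.Ioc (0:ℝ) (1/100), ∃ δ > (0:ℝ),
      ∀ (x : E4) (r : ℝ), 0 < r → ball x r ⊆ ball (0:E4) 2 →
      ∀ s ∈ Set.Ioo (0:ℝ) r,
      ∃ (n : ℕ) (Es : Fin n → Set E4) (c : Fin n → E4) (ρ : Fin n → ℝ),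
        -- (1) a splitting of Z ∩ B_x(r), with E_i ⊆ B_{x_i}(r_i)
        (Z ∩ ball x r = ⋃ i, Es i) ∧ (∀ i, Es i ⊆ ball (c i) (ρ i)) ∧
        -- (2) each radius is at least 4β̄s
        (∀ i, 4 * β' * s ≤ ρ i) ∧
        -- (3) either r_i ∈ [4β̄s, s], or B_{x_i}(r_i) ∩ D_δ(r_i) = ∅, where
        -- D_δ(t) = B(1) ∩ {z ∈ Z : I(z, βt/2) ≥ Λ − δ} with β = 1/10
        (∀ i, ρ i ∈ Set.Icc (4 * β' * s) s ∨
          ball (c i) (ρ i) ∩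
            (ball (0:E4) 1 ∩ {z | z ∈ Z ∧ Λ - δ ≤ I z ((1/10) * ρ i / 2)}) = ∅) ∧
        -- (4) bounded 2-dimensional volume
        (∑ i, (ρ i) ^ 2 ≤ K₄ * r ^ 2) := by
  classical
  obtain ⟨hb, -, hmono, hpin, hC, h3⟩ := hI
  obtain ⟨K, hK, η, hη, hp⟩ := packing_dyadic Z hZ I Λ C hC hb hmono h3
  obtain ⟨N₀, hN₀1, hN₀⟩ := line_count
  obtain ⟨N₁, hN₁1, hN₁⟩ := sep_card 2
  have hN₀r : (1:ℝ) ≤ N₀ := by exact_mod_cast hN₀1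
  have hN₁r : (1:ℝ) ≤ N₁ := by exact_mod_cast hN₁1
  obtain ⟨m, hm⟩ := exists_pow_lt_of_lt_one (show (0:ℝ) < min (1/25) (1 / (6 * N₀ * K)) by positivity)
    (show (1/2:ℝ) < 1 by norm_num)
  set lam : ℝ := (1/2)^m with hlamdef
  have hlam : 0 < lam := by positivity
  have hlam25 : lam < 1/25 := hm.trans_le (min_le_left _ _)
  have hlamK : lam * (6 * N₀ * K) ≤ 1 := by
    have := (hm.trans_le (min_le_right _ _)).le
    rwa [le_div_iff₀ (by positivity)] at this
  have hM : ((2^m : ℕ) : ℝ) * lam = 1 := by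
    rw [hlamdef]; push_cast; rw [← mul_pow]; norm_num
  obtain ⟨N, hN1, hN⟩ := sep_card (2 * ((2^m : ℕ) : ℝ))
  have heps := (hpin (lam/20) ⟨by positivity, by linarith⟩ lam ⟨hlam, by linarith⟩ (η/2) (by positivity)).1
  set e := epsFn (lam/20) lam (η/2) with hedef
  set δ := min (η/2) (e/2) with hδdef
  have hδ : 0 < δ := by positivity
  have hδη : δ ≤ η/2 := min_le_left _ _
  have hδe : δ < e := (min_le_right _ _).trans_lt (by linarith)
  set A : ℝ := N * lam^2 with hAdef
  have hA : 0 ≤ A := by positivity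
  set Bc : ℝ := 3 * N₀ * lam with hBdef
  have hBc : 0 ≤ Bc := by positivity
  set Kc : ℝ := 2 * K * (1 + A) with hKcdef
  have hKc1 : 1 ≤ Kc := by rw [hKcdef]; nlinarith
  have hKBc : K * Bc ≤ 1/2 := by rw [hBdef]; linarith
  have hKc : K * (1 + A + Bc * Kc) ≤ Kc := by
    have h : K * Bc * Kc ≤ 1/2 * Kc := mul_le_mul_of_nonneg_right hKBc (by linarith)
    have h' : K * (1 + A) = Kc / 2 := by rw [hKcdef]; ring
    linarith
  refine ⟨N₁ * Kc + 1, by nlinarith, lam/4, ⟨by positivity, by linarith⟩, δ, hδ, ?_⟩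
  intro x r hr hxr s hs
  obtain ⟨hs0, hsr⟩ := hs
  have hr2 : r ≤ 2 := by
    by_contra hcon
    push Not at hcon
    obtain ⟨v, hv⟩ : ∃ v : E4, ‖v‖ = 1 := ⟨EuclideanSpace.single 0 1, by simp⟩
    have g1 : x + (2:ℝ) • v ∈ ball (0:E4) 2 := hxr (by
      rw [mem_ball, dist_eq_norm, add_sub_cancel_left, norm_smul, hv]; norm_num; exact hcon)
    have g2 : x - (2:ℝ) • v ∈ ball (0:E4) 2 := hxr (by
      rw [mem_ball, dist_eq_norm, sub_sub_cancel_left, norm_neg, norm_smul, hv]; norm_num; exact hcon)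
    have g3 : dist (x + (2:ℝ) • v) (x - (2:ℝ) • v) = 4 := by
      rw [dist_eq_norm]
      have : x + (2:ℝ) • v - (x - (2:ℝ) • v) = (4:ℝ) • v := by module
      rw [this, norm_smul, hv]; norm_num
    have g4 := dist_triangle_right (x + (2:ℝ) • v) (x - (2:ℝ) • v) 0
    rw [mem_ball] at g1 g2
    linarith
  have hrec := cov_rec Z hZ I Λ K η δ lam s A Bc Kc hmono hlam (by linarith) hs0 hA hBc hK hKc1 hKc
    (fun r hr hr1 c s k L a b d => packing_lambda Z I Λ K η hp m lam hlamdef r hr hr1 c s k L a b d)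
    (fun c hc ρ hρ hρ1 z hz hzc hzI hr => bad_step Z hZ I Λ epsFn hb hpin N₀ hN₀ lam hlam (by linarith)
      (2^m) hM N hN η δ hη hδ hδη hδe s hs0 Kc (by linarith) c hc ρ hρ hρ1 z hz hzc hzI hr)
  obtain ⟨n, hn⟩ := exists_pow_lt_of_lt_one (show (0:ℝ) < s / (r/2) by positivity)
    (show lam < 1 by linarith)
  have hn' : r/2 * lam^n ≤ s := by
    rw [lt_div_iff₀ (by positivity)] at hn
    linarith
  obtain ⟨F, hF1, hF2, hF3, hF4⟩ := net_exists 2 N₁ hN₁ (r/2) (by positivity) x (Z ∩ ball x r) (by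
    intro p hp
    have : dist p x < r := hp.2
    linarith)
  have hu := CovP.union (Good := GoodB Z I Λ δ (lam * s) s) F (fun y => Z ∩ ball y (r/2))
    (fun _ => Kc * (r/2)^2)
    (fun y hy => hrec n y (hZ (hF1 y hy).1) (r/2) (by nlinarith) (by linarith) hn')
  obtain ⟨l, hl1, hl2, hl3⟩ := hu
  refine ⟨l.length, fun i => (Z ∩ ball x r) ∩ ball (l.get i).1 (l.get i).2, fun i => (l.get i).1,
    fun i => (l.get i).2, ?_, ?_, ?_, ?_, ?_⟩
  · ext z
    simp only [Set.mem_iUnion]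
    constructor
    · intro hz
      obtain ⟨y, hy, hd⟩ := hF3 z hz
      obtain ⟨b, hb, hdb⟩ := hl2 z ⟨y, hy, hz.1, hd⟩
      obtain ⟨i, rfl⟩ := List.mem_iff_get.1 hb
      exact ⟨i, hz, hdb⟩
    · rintro ⟨i, hz, _⟩
      exact hz
  · intro i z hz
    exact hz.2
  · intro i
    have := (hl1 _ (List.get_mem l i)).1
    linarith
  · intro i
    have hg := hl1 _ (List.get_mem l i)
    have h4 : 4 * (lam/4) * s = lam * s := by ring
    rcases hg.2 with h | h
    · left
      exact ⟨by rw [h4]; exact hg.1, h⟩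
    · right
      rw [Set.eq_empty_iff_forall_notMem]
      rintro z ⟨hz1, _, hz2, hz3⟩
      have := h z hz2 hz1
      have e20 : (1/10) * (l.get i).2 / 2 = (l.get i).2 / 20 := by ring
      rw [e20] at hz3
      linarith
  · have hsum : ∑ i : Fin l.length, (l.get i).2^2 = (l.map (fun b => b.2^2)).sum := by
      rw [← List.sum_ofFn]
      congr 1
      conv_rhs => rw [← List.ofFn_get l]
      rw [List.map_ofFn]
      rfl
    rw [hsum]
    refine hl3.trans ?_
    rw [Finset.sum_const, nsmul_eq_mul]
    have hFr : (F.card : ℝ) ≤ N₁ := by exact_mod_cast hF4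
    have : 0 ≤ N₁ * Kc := by positivity
    calc (F.card : ℝ) * (Kc * (r/2)^2) ≤ N₁ * (Kc * (r/2)^2) := by gcongr
      _ ≤ _ := by nlinarith [sq_nonneg r, mul_nonneg this (sq_nonneg r)]
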